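/- Assume G is a good normal subgroup of W~. Let L be a linear subspace of V~, let W~_L be the pointwise stabilizer of L in W~ (a reflection group on V~ by Steinberg's theorem) and G_L = G ∩ W~_L. Then G_L is a good normal subgroup of W~_L, and the canonical homomorphism W~_L/G_L -> W induced by the inclusion W~_L ⊆ W~ is injective with image equal to the pointwise stabilizer in W (acting on V) of the image p(L). -/

import Mathlib

open MvPolynomial

noncomputable section

namespace ReflQuot

variable {k : Type} [Field k]

/-- The action of an invertible matrix `g` on polynomial functions on `k^n`:
the linear form `X i` is sent to `∑ j, (g⁻¹) i j • X j`, so that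
`(g • f) (v) = f (g⁻¹ ⬝ v)`. -/
def matAct {n : ℕ} (g : Matrix.GeneralLinearGroup (Fin n) k) :
    MvPolynomial (Fin n) k →ₐ[k] MvPolynomial (Fin n) k :=
  aeval fun i => ∑ j, ((↑(g⁻¹) : Matrix (Fin n) (Fin n) k) i j) • X j

/-- The algebra endomorphism of `k[X_1,…,X_m]` sending `X i` to `∑ j, M i j • X j`. -/
def polyAct {m : ℕ} (M : Fin m → Fin m → k) :
    MvPolynomial (Fin m) k →ₐ[k] MvPolynomial (Fin m) k :=
  aeval fun i => ∑ j, M i j • X j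

/-- A reflection: an automorphism of finite order whose fixed-point subspace is a
hyperplane. -/
def IsReflection {n : ℕ} (M : Matrix (Fin n) (Fin n) k) : Prop :=
  IsOfFinOrder M ∧
    Module.finrank k (LinearMap.ker (Matrix.toLin' M - LinearMap.id)) + 1 = n

/-- A double reflection: finite order, fixed points of codimension 2. -/
def IsDoubleReflection {n : ℕ} (M : Matrix (Fin n) (Fin n) k) : Prop :=
  IsOfFinOrder M ∧
    Module.finrank k (LinearMap.ker (Matrix.toLin' M - LinearMap.id)) + 2 = n

/-- A reflection group: a group generated by its reflections. -/
def IsReflectionGroup {n : ℕ} (W : Subgroup (Matrix.GeneralLinearGroup (Fin n) k)) : Prop :=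
  Subgroup.closure {g | g ∈ W ∧ IsReflection ((g : Matrix (Fin n) (Fin n) k))} = W

/-- The algebra of `G`-invariant polynomials. -/
def invariants {n : ℕ} (G : Subgroup (Matrix.GeneralLinearGroup (Fin n) k)) :
    Subalgebra k (MvPolynomial (Fin n) k) where
  carrier := {f | ∀ g ∈ G, matAct g f = f}
  mul_mem' := fun {a b} ha hb g hg => by
    rw [map_mul, ha g hg, hb g hg]
  one_mem' := fun g _ => map_one (matAct g)
  add_mem' := fun {a b} ha hb g hg => by
    rw [map_add, ha g hg, hb g hg]
  zero_mem' := fun g _ => map_zero (matAct g)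
  algebraMap_mem' := fun r g _ => (matAct g).commutes r

/-- The linear span of products of two positive-degree invariants, i.e. `(B^G_+)^2`. -/
def sqSpan {n : ℕ} (G : Subgroup (Matrix.GeneralLinearGroup (Fin n) k)) :
    Submodule k (MvPolynomial (Fin n) k) :=
  Submodule.span k {f | ∃ u ∈ invariants G, ∃ v ∈ invariants G,
    constantCoeff u = 0 ∧ constantCoeff v = 0 ∧ f = u * v}

/-- The ideal of positive-degree elements of the polynomial ring. -/
def idealPlus (k : Type) [Field k] (m : ℕ) : Ideal (MvPolynomial (Fin m) k) :=
  Ideal.span (Set.range X)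

/-- The ideal `I` of relations between the generators `p i` of the invariant algebra:
the kernel of `k[V] = k[X_1,…,X_m] → B^G`, `X i ↦ p i`. -/
def relIdeal {n m : ℕ} (p : Fin m → MvPolynomial (Fin n) k) :
    Ideal (MvPolynomial (Fin m) k) :=
  RingHom.ker (aeval p : MvPolynomial (Fin m) k →ₐ[k] MvPolynomial (Fin n) k)

/-- The context: `Wt` is a finite reflection group on `k^n`, `G` a normal subgroup of `Wt`,
`p` a minimal system of homogeneous generators (of degrees `d`) of the invariant algebra
`B^G` whose span is `Wt`-stable (i.e. a graded `W`-equivariant section of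
`B^G_+ → B^G_+/(B^G_+)^2`), and `c w` the matrix of the action of `w` on the span of the
`p i`, giving the induced action of `W = Wt/G` on `V = k^m`. -/
structure QuotSetup {n m : ℕ} (Wt G : Subgroup (Matrix.GeneralLinearGroup (Fin n) k))
    (p : Fin m → MvPolynomial (Fin n) k) (d : Fin m → ℕ)
    (c : ↥Wt → Fin m → Fin m → k) : Prop where
  finite : (Wt : Set (Matrix.GeneralLinearGroup (Fin n) k)).Finite
  reflGroup : IsReflectionGroup Wt
  le : G ≤ Wt
  normal : ∀ w ∈ Wt, ∀ g ∈ G, w * g * w⁻¹ ∈ G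
  homog : ∀ i, (p i).IsHomogeneous (d i)
  dpos : ∀ i, 0 < d i
  gen : Algebra.adjoin k (Set.range p) = invariants G
  minimal : ∀ a : Fin m → k, (∑ i, a i • p i) ∈ sqSpan G → a = 0
  equivar : ∀ (w : ↥Wt) (i), matAct (w : Matrix.GeneralLinearGroup (Fin n) k) (p i)
      = ∑ j, c w i j • p j

/-- `W = Wt/G` acts trivially on the conormal module `I/(A_+ I)`. -/
def TrivialConormal {n m : ℕ} (Wt : Subgroup (Matrix.GeneralLinearGroup (Fin n) k))
    (p : Fin m → MvPolynomial (Fin n) k) (c : ↥Wt → Fin m → Fin m → k) : Prop :=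
  ∀ w : ↥Wt, ∀ f ∈ relIdeal p, polyAct (c w) f - f ∈ idealPlus k m * relIdeal p

/-- `G` is of complete intersection: `I` is generated by `dim V - dim Vt = m - n` elements. -/
def IsCompleteIntersection {n m : ℕ} (p : Fin m → MvPolynomial (Fin n) k) : Prop :=
  ∃ s : Finset (MvPolynomial (Fin m) k), s.card = m - n ∧ Ideal.span (s : Set _) = relIdeal p

/-- `G` is a good normal subgroup of `Wt`. -/
def IsGoodQuot {n m : ℕ} (Wt : Subgroup (Matrix.GeneralLinearGroup (Fin n) k))
    (p : Fin m → MvPolynomial (Fin n) k) (c : ↥Wt → Fin m → Fin m → k) : Prop :=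
  IsCompleteIntersection p ∧ TrivialConormal Wt p c


/-- The pointwise stabilizer of a subspace `L` in `GL_n(k)`. -/
def pointStab {n : ℕ} (L : Submodule k (Fin n → k)) :
    Subgroup (Matrix.GeneralLinearGroup (Fin n) k) where
  carrier := {g | ∀ x ∈ L, Matrix.mulVec (g : Matrix (Fin n) (Fin n) k) x = x}
  one_mem' := fun x _ => Matrix.one_mulVec x
  mul_mem' := fun {a b} ha hb x hx => by
    rw [Units.val_mul, ← Matrix.mulVec_mulVec, hb x hx, ha x hx]
  inv_mem' := fun {a} ha x hx => by
    have h1 : Matrix.mulVec (↑(a⁻¹) : Matrix (Fin n) (Fin n) k)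
        (Matrix.mulVec (↑a : Matrix (Fin n) (Fin n) k) x) = x := by
      rw [Matrix.mulVec_mulVec, ← Units.val_mul, inv_mul_cancel, Units.val_one,
        Matrix.one_mulVec]
    rw [ha x hx] at h1
    exact h1

/-- The set of reflecting hyperplanes of a subgroup `W` of `GL_n(k)`. -/
def reflHyps {n : ℕ} (W : Subgroup (Matrix.GeneralLinearGroup (Fin n) k)) :
    Set (Submodule k (Fin n → k)) :=
  {H | ∃ g ∈ W, IsReflection ((g : Matrix (Fin n) (Fin n) k)) ∧
      H = LinearMap.ker (Matrix.toLin' ((g : Matrix (Fin n) (Fin n) k)) - LinearMap.id)}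

/-- The set `A'(Wt)` of reflecting hyperplanes `H` of `Wt` such that `Wt_H ≠ G_H`. -/
def reflHyps' {n : ℕ} (Wt G : Subgroup (Matrix.GeneralLinearGroup (Fin n) k)) :
    Set (Submodule k (Fin n → k)) :=
  {H | H ∈ reflHyps Wt ∧ ¬ (Wt ⊓ pointStab H ≤ G)}

/-- `Wt_H` and `Wt_{H'}` have the same image in `W = Wt/G`. -/
def imageEq {n : ℕ} (Wt G : Subgroup (Matrix.GeneralLinearGroup (Fin n) k))
    (H H' : Submodule k (Fin n → k)) : Prop :=
  {x | ∃ g ∈ G, ∃ u ∈ Wt ⊓ pointStab H, x = g * u}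
    = {x | ∃ g ∈ G, ∃ u ∈ Wt ⊓ pointStab H', x = g * u}

/-- `e_H = |G_H|`. -/
def eH {n : ℕ} (G : Subgroup (Matrix.GeneralLinearGroup (Fin n) k))
    (H : Submodule k (Fin n → k)) : ℕ :=
  Nat.card ↥(G ⊓ pointStab H)

/-- The map `p : Vt → V`, `x ↦ (p 1 (x), …, p m (x))`. -/
def pMap {n m : ℕ} (p : Fin m → MvPolynomial (Fin n) k) (x : Fin n → k) : Fin m → k :=
  fun i => eval x (p i)

/-- The matrix of the action of (the image in `W` of) `w` on `V = k^m`. -/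
def qMat {n m : ℕ} {Wt : Subgroup (Matrix.GeneralLinearGroup (Fin n) k)}
    (c : ↥Wt → Fin m → Fin m → k) (w : ↥Wt) : Matrix (Fin m) (Fin m) k :=
  Matrix.of (c w⁻¹)

/-- The set of reflecting hyperplanes of `W = Wt/G` acting on `V = k^m`. -/
def reflHypsV {n m : ℕ} {Wt : Subgroup (Matrix.GeneralLinearGroup (Fin n) k)}
    (c : ↥Wt → Fin m → Fin m → k) : Set (Submodule k (Fin m → k)) :=
  {K | ∃ w : ↥Wt, IsReflection (qMat c w) ∧
      K = LinearMap.ker (Matrix.toLin' (qMat c w) - LinearMap.id)}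

/-- The underlying matrix of an element of a subgroup of `GL_n(k)`. -/
def matOf {n : ℕ} {Wt : Subgroup (Matrix.GeneralLinearGroup (Fin n) k)} (w : ↥Wt) :
    Matrix (Fin n) (Fin n) k :=
  ((w : Matrix.GeneralLinearGroup (Fin n) k) : Matrix (Fin n) (Fin n) k)

/-- The maximal ideal of polynomials vanishing at the point `x`. -/
def ptIdeal {n : ℕ} (x : Fin n → k) : Ideal (MvPolynomial (Fin n) k) :=
  RingHom.ker (eval x)

lemma mem_ptIdeal {n : ℕ} {x : Fin n → k} {f : MvPolynomial (Fin n) k} :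
    f ∈ ptIdeal x ↔ eval x f = 0 := Iff.rfl

/-- The translation `f ↦ (x ↦ f (x + v))`. -/
def translate {n : ℕ} (v : Fin n → k) :
    MvPolynomial (Fin n) k →ₐ[k] MvPolynomial (Fin n) k :=
  aeval fun i => X i + C (v i)

lemma eval_translate {n : ℕ} (v x : Fin n → k) (f : MvPolynomial (Fin n) k) :
    eval x (translate v f) = eval (x + v) f := by
  have h : ((eval x).comp (translate v).toRingHom) = eval (x + v) := by
    apply MvPolynomial.ringHom_ext
    · intro r; simp [translate]
    · intro i; simp [translate]
  exact congrArg (fun φ => φ f) h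

lemma eval_matAct {n : ℕ} (g : Matrix.GeneralLinearGroup (Fin n) k) (x : Fin n → k)
    (f : MvPolynomial (Fin n) k) :
    eval x (matAct g f) =
      eval (Matrix.mulVec (↑(g⁻¹) : Matrix (Fin n) (Fin n) k) x) f := by
  have h : ((eval x).comp (matAct g).toRingHom) =
      eval (Matrix.mulVec (↑(g⁻¹) : Matrix (Fin n) (Fin n) k) x) := by
    apply MvPolynomial.ringHom_ext
    · intro r; simp [matAct]
    · intro i
      simp only [matAct, AlgHom.toRingHom_eq_coe, RingHom.coe_comp, RingHom.coe_coe,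
        Function.comp_apply, aeval_X, map_sum, smul_eval, eval_X]
      rfl
  exact congrArg (fun φ => φ f) h

lemma eval_aeval {n m : ℕ} (p : Fin m → MvPolynomial (Fin n) k) (x : Fin n → k)
    (f : MvPolynomial (Fin m) k) : eval x (aeval p f) = eval (pMap p x) f := by
  have h : ((eval x).comp (aeval p : MvPolynomial (Fin m) k →ₐ[k] _).toRingHom) =
      eval (pMap p x) := by
    apply MvPolynomial.ringHom_ext
    · intro r; simp
    · intro i; simp [pMap]
  exact congrArg (fun φ => φ f) h

lemma matAct_one {n : ℕ} (f : MvPolynomial (Fin n) k) :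
    matAct (1 : Matrix.GeneralLinearGroup (Fin n) k) f = f := by
  have h : matAct (1 : Matrix.GeneralLinearGroup (Fin n) k) = AlgHom.id k _ := by
    apply MvPolynomial.algHom_ext
    intro i
    simp [matAct, Matrix.one_apply, Finset.sum_ite_eq]
  rw [h]; rfl

lemma matAct_mul {n : ℕ} (g h : Matrix.GeneralLinearGroup (Fin n) k)
    (f : MvPolynomial (Fin n) k) : matAct (g * h) f = matAct g (matAct h f) := by
  have e : matAct (g * h) = (matAct g).comp (matAct h) := by
    apply MvPolynomial.algHom_ext
    intro i
    simp only [matAct, mul_inv_rev, AlgHom.coe_comp, Function.comp_apply, aeval_X, map_sum,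
      map_smul, Units.val_mul, Matrix.mul_apply, Finset.sum_smul, Finset.smul_sum, mul_smul]
    exact Finset.sum_comm
  rw [e]; rfl

lemma translate_matAct [CharZero k] {n : ℕ} (g : Matrix.GeneralLinearGroup (Fin n) k)
    (v : Fin n → k) (hv : Matrix.mulVec (g : Matrix (Fin n) (Fin n) k) v = v)
    (f : MvPolynomial (Fin n) k) :
    translate v (matAct g f) = matAct g (translate v f) := by
  apply MvPolynomial.funext
  intro x
  have hv' : Matrix.mulVec (↑(g⁻¹) : Matrix (Fin n) (Fin n) k) v = v := by
    conv_lhs => rw [← hv]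
    rw [Matrix.mulVec_mulVec, ← Units.val_mul, inv_mul_cancel, Units.val_one, Matrix.one_mulVec]
  rw [eval_translate, eval_matAct, eval_matAct, eval_translate, Matrix.mulVec_add, hv']

lemma translate_neg_translate [CharZero k] {n : ℕ} (v : Fin n → k)
    (f : MvPolynomial (Fin n) k) : translate v (translate (-v) f) = f := by
  apply MvPolynomial.funext
  intro x
  rw [eval_translate, eval_translate, add_neg_cancel_right]

lemma mem_pow_of_map_mem {n m : ℕ} (φ : MvPolynomial (Fin n) k →ₐ[k] MvPolynomial (Fin m) k)
    {I : Ideal (MvPolynomial (Fin n) k)} {J : Ideal (MvPolynomial (Fin m) k)}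
    (h : ∀ f ∈ I, φ f ∈ J) {N : ℕ} {f : MvPolynomial (Fin n) k} (hf : f ∈ I ^ N) :
    φ f ∈ J ^ N := by
  have h1 : I.map φ ≤ J := Ideal.map_le_iff_le_comap.mpr h
  have h2 := Ideal.mem_map_of_mem φ hf
  rw [Ideal.map_pow] at h2
  exact Ideal.pow_right_mono h1 N h2

lemma translate_mem_pow {n N : ℕ} {v : Fin n → k} {f : MvPolynomial (Fin n) k}
    (hf : f ∈ ptIdeal v ^ N) : translate v f ∈ ptIdeal (0 : Fin n → k) ^ N := by
  refine mem_pow_of_map_mem _ (fun f hf => ?_) hf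
  rw [mem_ptIdeal] at *
  rw [eval_translate, zero_add, hf]

lemma mem_pow_of_translate [CharZero k] {n N : ℕ} {v : Fin n → k} {f : MvPolynomial (Fin n) k}
    (hf : translate v f ∈ ptIdeal (0 : Fin n → k) ^ N) : f ∈ ptIdeal v ^ N := by
  have h := mem_pow_of_map_mem (translate (-v)) (J := ptIdeal v) (fun f hf => ?_) hf
  · have e := translate_neg_translate (-v) f
    rw [neg_neg] at e
    rwa [e] at h
  · rw [mem_ptIdeal] at *
    rw [eval_translate, add_neg_cancel, hf]

lemma matAct_mem_pow {n N : ℕ} (g : Matrix.GeneralLinearGroup (Fin n) k) {v : Fin n → k}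
    {f : MvPolynomial (Fin n) k} (hf : f ∈ ptIdeal v ^ N) :
    matAct g f ∈ ptIdeal (Matrix.mulVec (g : Matrix (Fin n) (Fin n) k) v) ^ N := by
  refine mem_pow_of_map_mem _ (fun f hf => ?_) hf
  rw [mem_ptIdeal] at *
  rw [eval_matAct, Matrix.mulVec_mulVec, ← Units.val_mul, inv_mul_cancel, Units.val_one,
    Matrix.one_mulVec, hf]

/-- Lagrange interpolation: a polynomial equal to `1` at `v` and `0` on a finite set
avoiding `v`. -/
lemma exists_eval_one_zero {n : ℕ} (v : Fin n → k) (S : Finset (Fin n → k)) (hS : v ∉ S) :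
    ∃ s : MvPolynomial (Fin n) k, eval v s = 1 ∧ ∀ w ∈ S, eval w s = 0 := by
  have h : ∀ w : Fin n → k, ∃ s : MvPolynomial (Fin n) k,
      w ≠ v → eval v s = 1 ∧ eval w s = 0 := by
    intro w
    by_cases hw : w = v
    · exact ⟨0, fun h => absurd hw h⟩
    · obtain ⟨l, hl⟩ := Function.ne_iff.mp hw
      refine ⟨C ((v l - w l)⁻¹) * (X l - C (w l)), fun _ => ⟨?_, ?_⟩⟩
      · have : v l - w l ≠ 0 := sub_ne_zero.mpr (Ne.symm hl)
        simp [this]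
      · simp
  choose s hs using h
  refine ⟨∏ w ∈ S, s w, ?_, fun w hw => ?_⟩
  · rw [map_prod]
    exact Finset.prod_eq_one fun w hw => (hs w fun h => hS (h ▸ hw)).1
  · rw [map_prod]
    exact Finset.prod_eq_zero hw (hs w fun h => hS (h ▸ hw)).2

lemma isCoprime_ptIdeal {n : ℕ} {v w : Fin n → k} (h : v ≠ w) :
    IsCoprime (ptIdeal v) (ptIdeal w) := by
  obtain ⟨s, hs1, hs2⟩ := exists_eval_one_zero v {w} (by simpa using h)
  rw [Ideal.isCoprime_iff_exists]
  refine ⟨1 - s, ?_, s, hs2 w (by simp), by ring⟩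
  rw [mem_ptIdeal, map_sub, hs1, map_one, sub_self]

/-- A polynomial that is `1` to order `N` at `v` and `0` to order `N` on a finite set
avoiding `v`. -/
lemma exists_bump {n : ℕ} (v : Fin n → k) (S : Finset (Fin n → k)) (hS : v ∉ S) (N : ℕ) :
    ∃ s : MvPolynomial (Fin n) k, s - 1 ∈ ptIdeal v ^ N ∧ ∀ w ∈ S, s ∈ ptIdeal w ^ N := by
  obtain ⟨s, hs1, hs2⟩ := exists_eval_one_zero v S hS
  by_cases hN : N = 0
  · subst hN
    exact ⟨1, by simp, by simp⟩
  refine ⟨1 - (1 - s ^ N) ^ N, ?_, fun w hw => ?_⟩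
  · have : 1 - (1 - s ^ N) ^ N - 1 = - (1 - s ^ N) ^ N := by ring
    rw [this]
    refine neg_mem (Ideal.pow_mem_pow ?_ N)
    rw [mem_ptIdeal, map_sub, map_pow, hs1]
    simp
  · have h1 : s ^ N ∣ 1 - (1 - s ^ N) ^ N := by
      have := sub_dvd_pow_sub_pow (1 : MvPolynomial (Fin n) k) (1 - s ^ N) N
      simpa using this
    exact Ideal.mem_of_dvd _ h1 (Ideal.pow_mem_pow (hs2 w hw) N)

/-- Invariant polynomials are exactly the polynomials in a generating family. -/
lemma mem_invariants_iff_exists {n m : ℕ} {G : Subgroup (Matrix.GeneralLinearGroup (Fin n) k)}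
    {p : Fin m → MvPolynomial (Fin n) k}
    (gen : Algebra.adjoin k (Set.range p) = invariants G) {f : MvPolynomial (Fin n) k} :
    f ∈ invariants G ↔ ∃ u : MvPolynomial (Fin m) k, aeval p u = f := by
  rw [← gen, Algebra.adjoin_range_eq_range_aeval]
  rfl

/-- The Reynolds operator. -/
def reynolds {n : ℕ} (G : Subgroup (Matrix.GeneralLinearGroup (Fin n) k)) [Fintype G]
    (f : MvPolynomial (Fin n) k) : MvPolynomial (Fin n) k :=
  C ((Fintype.card G : k)⁻¹) * ∑ g : G, matAct (g : Matrix.GeneralLinearGroup (Fin n) k) f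

lemma sum_matAct_mem_invariants {n : ℕ} (G : Subgroup (Matrix.GeneralLinearGroup (Fin n) k))
    [Fintype G] (f : MvPolynomial (Fin n) k) :
    ∑ g : G, matAct (g : Matrix.GeneralLinearGroup (Fin n) k) f ∈ invariants G := by
  intro h hh
  rw [map_sum]
  exact Fintype.sum_equiv (Equiv.mulLeft (⟨h, hh⟩ : G)) _ _
    (fun g => (matAct_mul h g f).symm)

lemma reynolds_mem {n : ℕ} (G : Subgroup (Matrix.GeneralLinearGroup (Fin n) k)) [Fintype G]
    (f : MvPolynomial (Fin n) k) : reynolds G f ∈ invariants G :=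
  mul_mem ((invariants G).algebraMap_mem _) (sum_matAct_mem_invariants G f)

lemma reynolds_mul {n : ℕ} (G : Subgroup (Matrix.GeneralLinearGroup (Fin n) k)) [Fintype G]
    (f : MvPolynomial (Fin n) k) {h : MvPolynomial (Fin n) k} (hh : h ∈ invariants G) :
    reynolds G (f * h) = reynolds G f * h := by
  have : ∀ g : G, matAct (g : Matrix.GeneralLinearGroup (Fin n) k) (f * h)
      = matAct (g : Matrix.GeneralLinearGroup (Fin n) k) f * h := fun g => by
    rw [map_mul, hh g g.2]
  simp only [reynolds, this, ← Finset.sum_mul, mul_assoc]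

lemma reynolds_of_mem [CharZero k] {n : ℕ} (G : Subgroup (Matrix.GeneralLinearGroup (Fin n) k))
    [Fintype G] {h : MvPolynomial (Fin n) k} (hh : h ∈ invariants G) : reynolds G h = h := by
  have : ∀ g : G, matAct (g : Matrix.GeneralLinearGroup (Fin n) k) h = h := fun g => hh g g.2
  have hc : (Fintype.card G : k) ≠ 0 := Nat.cast_ne_zero.mpr Fintype.card_ne_zero
  simp only [reynolds, this, Finset.sum_const, Finset.card_univ, nsmul_eq_mul]
  rw [← mul_assoc, ← map_natCast (C : k →+* MvPolynomial (Fin n) k), ← C_mul,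
    inv_mul_cancel₀ hc, C_1, one_mul]

lemma reynolds_add {n : ℕ} (G : Subgroup (Matrix.GeneralLinearGroup (Fin n) k)) [Fintype G]
    (f h : MvPolynomial (Fin n) k) : reynolds G (f + h) = reynolds G f + reynolds G h := by
  simp only [reynolds, map_add, Finset.sum_add_distrib, mul_add]

/-- The monic polynomial `∏ g, (T - g • h)`. -/
def orbitPoly {n : ℕ} (G : Subgroup (Matrix.GeneralLinearGroup (Fin n) k)) [Fintype G]
    (h : MvPolynomial (Fin n) k) : Polynomial (MvPolynomial (Fin n) k) :=
  ∏ g : G, (Polynomial.X - Polynomial.C (matAct (g : Matrix.GeneralLinearGroup (Fin n) k) h))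

lemma orbitPoly_coeff_mem {n : ℕ} (G : Subgroup (Matrix.GeneralLinearGroup (Fin n) k))
    [Fintype G] (h : MvPolynomial (Fin n) k) (i : ℕ) :
    (orbitPoly G h).coeff i ∈ invariants G := by
  intro g hg
  have e : (orbitPoly G h).map (matAct g).toRingHom = orbitPoly G h := by
    rw [orbitPoly, Polynomial.map_prod]
    refine Fintype.prod_equiv (Equiv.mulLeft (⟨g, hg⟩ : G)) _ _ (fun a => ?_)
    simp [matAct_mul]
  conv_rhs => rw [← e]
  rw [Polynomial.coeff_map]
  rfl

lemma orbitPoly_eval_self {n : ℕ} (G : Subgroup (Matrix.GeneralLinearGroup (Fin n) k))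
    [Fintype G] (h : MvPolynomial (Fin n) k) : (orbitPoly G h).eval h = 0 := by
  rw [orbitPoly, Polynomial.eval_prod]
  refine Finset.prod_eq_zero (Finset.mem_univ (1 : G)) ?_
  simp [matAct_one]

lemma sub_eval_mem_map {n m : ℕ} {G : Subgroup (Matrix.GeneralLinearGroup (Fin n) k)}
    {p : Fin m → MvPolynomial (Fin n) k}
    (gen : Algebra.adjoin k (Set.range p) = invariants G) (v : Fin n → k)
    {f : MvPolynomial (Fin n) k} (hf : f ∈ invariants G) :
    f - C (eval v f) ∈ (ptIdeal (pMap p v)).map (aeval p) := by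
  obtain ⟨u, rfl⟩ := (mem_invariants_iff_exists gen).mp hf
  have h : u - C (eval (pMap p v) u) ∈ ptIdeal (pMap p v) := by
    rw [mem_ptIdeal]; simp
  have := Ideal.mem_map_of_mem (aeval p : MvPolynomial (Fin m) k →ₐ[k] _) h
  rwa [map_sub, algHom_C, ← eval_aeval] at this

lemma prod_sub_eval_mem_map {n m : ℕ} {G : Subgroup (Matrix.GeneralLinearGroup (Fin n) k)}
    [Fintype G] {p : Fin m → MvPolynomial (Fin n) k}
    (gen : Algebra.adjoin k (Set.range p) = invariants G) (v : Fin n → k)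
    (h : MvPolynomial (Fin n) k) :
    ∏ g : G, (h - C (eval v (matAct (g : Matrix.GeneralLinearGroup (Fin n) k) h)))
      ∈ (ptIdeal (pMap p v)).map (aeval p) := by
  set J := (ptIdeal (pMap p v)).map (aeval p) with hJ
  let q := Ideal.Quotient.mk J
  have e : (orbitPoly G h).map q = (orbitPoly G h).map (q.comp (C.comp (eval v))) := by
    ext i
    rw [Polynomial.coeff_map, Polynomial.coeff_map]
    exact Ideal.Quotient.eq.mpr (sub_eval_mem_map gen v (orbitPoly_coeff_mem G h i))
  have e2 := congrArg (Polynomial.eval (q h)) e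
  rw [Polynomial.eval_map_apply, orbitPoly_eval_self, map_zero, orbitPoly, Polynomial.map_prod,
    Polynomial.eval_prod] at e2
  rw [← Ideal.Quotient.eq_zero_iff_mem, map_prod, e2]
  refine Finset.prod_congr rfl fun g _ => ?_
  simp [q]

/-- A `G`-invariant polynomial vanishing to high order at `v` lies in a high power of the maximal
ideal of the image of `v` in the quotient. -/
lemma exists_order_bound [CharZero k] {n m : ℕ}
    {G : Subgroup (Matrix.GeneralLinearGroup (Fin n) k)}
    [Finite G] {p : Fin m → MvPolynomial (Fin n) k}
    (gen : Algebra.adjoin k (Set.range p) = invariants G) (v : Fin n → k) (j : ℕ) :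
    ∃ N, ∀ f ∈ invariants G, f ∈ ptIdeal v ^ N →
      ∃ u ∈ ptIdeal (pMap p v) ^ j, aeval p u = f := by
  classical
  have := Fintype.ofFinite G
  let S : Finset (Fin n → k) := Finset.univ.image fun g : G =>
    Matrix.mulVec ((g : Matrix.GeneralLinearGroup (Fin n) k) : Matrix (Fin n) (Fin n) k) v
  set J := (ptIdeal (pMap p v)).map (aeval p) with hJ
  have hrad : (⨅ w ∈ S, ptIdeal w) ≤ J.radical := by
    intro h hh
    simp only [Ideal.mem_iInf] at hh
    refine ⟨Fintype.card G, ?_⟩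
    have := prod_sub_eval_mem_map gen v h
    convert! this
    rw [← Finset.card_univ, ← Finset.prod_const]
    refine Finset.prod_congr rfl fun g _ => ?_
    have h2 := hh _ (Finset.mem_image_of_mem _ (Finset.mem_univ g⁻¹))
    rw [mem_ptIdeal] at h2
    rw [eval_matAct]
    have h3 : eval (Matrix.mulVec (↑((g : Matrix.GeneralLinearGroup (Fin n) k)⁻¹) :
      Matrix (Fin n) (Fin n) k) v) h = 0 := h2
    rw [h3, C_0, sub_zero]
  obtain ⟨M, hM⟩ := Ideal.exists_pow_le_of_le_radical_of_fg hrad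
    (IsNoetherian.noetherian _)
  refine ⟨M * j, fun f hf hfv => ?_⟩
  have h1 : f ∈ ∏ w ∈ S, ptIdeal w ^ (M * j) := by
    rw [Ideal.prod_eq_iInf_of_pairwise_isCoprime
      (fun a _ b _ hab => (isCoprime_ptIdeal hab).pow)]
    simp only [Ideal.mem_iInf]
    intro w hw
    obtain ⟨g, -, rfl⟩ := Finset.mem_image.mp hw
    have := matAct_mem_pow (g : Matrix.GeneralLinearGroup (Fin n) k) hfv
    rwa [hf g g.2] at this
  have h2 : f ∈ (ptIdeal (pMap p v) ^ j).map (aeval p) := by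
    rw [Ideal.map_pow]
    rw [Finset.prod_pow, Ideal.prod_eq_iInf_of_pairwise_isCoprime
      (fun a _ b _ hab => isCoprime_ptIdeal hab), pow_mul] at h1
    exact Ideal.pow_right_mono hM j h1
  have h3 : ∀ f ∈ (ptIdeal (pMap p v) ^ j).map (aeval p), ∀ b,
      ∃ u ∈ ptIdeal (pMap p v) ^ j, aeval p u = reynolds G (b * f) := by
    intro f hf
    induction hf using Submodule.span_induction with
    | mem x hx =>
      obtain ⟨u, hu, rfl⟩ := hx
      intro b
      obtain ⟨a, ha⟩ := (mem_invariants_iff_exists gen).mp (reynolds_mem G b)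
      have hpu : aeval p u ∈ invariants G := (mem_invariants_iff_exists gen).mpr ⟨u, rfl⟩
      refine ⟨a * u, Ideal.mul_mem_left _ _ hu, ?_⟩
      rw [map_mul, ha]
      exact (reynolds_mul G b hpu).symm
    | zero => exact fun b => ⟨0, zero_mem _, by simp [reynolds]⟩
    | add x y _ _ hx hy =>
      intro b
      obtain ⟨u, hu, hu'⟩ := hx b
      obtain ⟨w, hw, hw'⟩ := hy b
      exact ⟨u + w, add_mem hu hw, by rw [map_add, hu', hw', mul_add, reynolds_add]⟩
    | smul a x _ hx =>
      intro b
      obtain ⟨u, hu, hu'⟩ := hx (b * a)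
      exact ⟨u, hu, by rw [hu', smul_eq_mul, mul_assoc]⟩
  obtain ⟨u, hu, hu'⟩ := h3 f h2 1
  exact ⟨u, hu, by rw [hu', one_mul, reynolds_of_mem G hf]⟩

lemma mem_pointStab {n : ℕ} {L : Submodule k (Fin n → k)}
    {g : Matrix.GeneralLinearGroup (Fin n) k} :
    g ∈ pointStab L ↔ ∀ x ∈ L, Matrix.mulVec (g : Matrix (Fin n) (Fin n) k) x = x := Iff.rfl

/-- If every `x ∈ L` is fixed by some member of a finite family of matrices, then one
member fixes `L` pointwise. -/
lemma exists_fixing_of_forall_exists [CharZero k] {n : ℕ} {ι : Type*} [Finite ι]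
    (M : ι → Matrix (Fin n) (Fin n) k) (L : Submodule k (Fin n → k))
    (h : ∀ x ∈ L, ∃ i, Matrix.mulVec (M i) x = x) :
    ∃ i, ∀ x ∈ L, Matrix.mulVec (M i) x = x := by
  let P : ι → Submodule k L := fun i =>
    LinearMap.ker (((Matrix.toLin' (M i)) - LinearMap.id).comp L.subtype)
  have hP : ∀ i (x : L), x ∈ P i ↔ Matrix.mulVec (M i) x = x := by
    intro i x
    simp [P, sub_eq_zero]
  have hc : ⋃ i, (P i : Set L) = Set.univ := by
    rw [Set.eq_univ_iff_forall]
    intro x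
    obtain ⟨i, hi⟩ := h x x.2
    exact Set.mem_iUnion.mpr ⟨i, (hP i x).mpr hi⟩
  obtain ⟨i, hi⟩ := Subspace.exists_eq_top_of_iUnion_eq_univ hc
  refine ⟨i, fun x hx => (hP i ⟨x, hx⟩).mp ?_⟩
  rw [hi]; trivial

/-- A point of `L` whose stabilizer in `G` is the pointwise stabilizer of `L`. -/
lemma exists_generic [CharZero k] {n : ℕ} (G : Subgroup (Matrix.GeneralLinearGroup (Fin n) k))
    [Finite G] (L : Submodule k (Fin n → k)) :
    ∃ v ∈ L, ∀ g ∈ G, Matrix.mulVec (g : Matrix (Fin n) (Fin n) k) v = v → g ∈ pointStab L := by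
  by_contra! hcon
  obtain ⟨⟨g, hg⟩, hi⟩ := exists_fixing_of_forall_exists
    (ι := {g : G // (g : Matrix.GeneralLinearGroup (Fin n) k) ∉ pointStab L})
    (fun g => (((g : G) : Matrix.GeneralLinearGroup (Fin n) k) : Matrix (Fin n) (Fin n) k)) L
    (fun x hx => by
      obtain ⟨g, hg, h1, h2⟩ := hcon x hx
      exact ⟨⟨⟨g, hg⟩, h2⟩, h1⟩)
  exact hg (mem_pointStab.mpr hi)

/-- Polynomials invariant under the stabilizer of `v` in `G` are approximated to any order at `v`
by `G`-invariant ones. -/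
lemma exists_invariant_approx [CharZero k] {n : ℕ}
    (G H : Subgroup (Matrix.GeneralLinearGroup (Fin n) k)) [Finite G] (v : Fin n → k)
    (hH : ∀ g ∈ G, g ∈ H ↔ Matrix.mulVec (g : Matrix (Fin n) (Fin n) k) v = v)
    {F : MvPolynomial (Fin n) k} (hF : F ∈ invariants H) (N : ℕ) :
    ∃ f ∈ invariants G, F - f ∈ ptIdeal v ^ N := by
  classical
  have := Fintype.ofFinite G
  let S : Finset (Fin n → k) := (Finset.univ.image fun g : G =>
    Matrix.mulVec ((g : Matrix.GeneralLinearGroup (Fin n) k) : Matrix (Fin n) (Fin n) k) v).erase v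
  obtain ⟨s, hs1, hs2⟩ := exists_bump v S (Finset.notMem_erase _ _) N
  let T : Finset G := Finset.univ.filter fun g : G =>
    (g : Matrix.GeneralLinearGroup (Fin n) k) ∈ H
  have hT : (T.card : k) ≠ 0 := by
    refine Nat.cast_ne_zero.mpr (Finset.card_ne_zero_of_mem (a := 1) ?_)
    simp [T, one_mem]
  have key : ∀ g : G, matAct (g : Matrix.GeneralLinearGroup (Fin n) k) (s * F)
      - (if g ∈ T then F else 0) ∈ ptIdeal v ^ N := by
    intro g
    split_ifs with hg
    · have hgH : (g : Matrix.GeneralLinearGroup (Fin n) k) ∈ H := (Finset.mem_filter.mp hg).2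
      have h1 := matAct_mem_pow (g : Matrix.GeneralLinearGroup (Fin n) k) hs1
      rw [(hH g g.2).mp hgH, map_sub, map_one] at h1
      rw [map_mul, hF g hgH]
      have := Ideal.mul_mem_right F _ h1
      rwa [sub_mul, one_mul] at this
    · rw [sub_zero, map_mul]
      refine Ideal.mul_mem_right _ _ ?_
      set g' : Matrix.GeneralLinearGroup (Fin n) k := (g : Matrix.GeneralLinearGroup (Fin n) k)
        with hg'
      have hne : g'⁻¹ ∉ H := fun h => hg (Finset.mem_filter.mpr ⟨Finset.mem_univ _, by
        simpa using inv_mem h⟩)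
      have hw : Matrix.mulVec ((g'⁻¹ : Matrix.GeneralLinearGroup (Fin n) k) :
          Matrix (Fin n) (Fin n) k) v ∈ S := by
        refine Finset.mem_erase.mpr ⟨fun h => hne ((hH _ (inv_mem g.2)).mpr h), ?_⟩
        exact Finset.mem_image_of_mem _ (Finset.mem_univ g⁻¹)
      have h1 := matAct_mem_pow g' (hs2 _ hw)
      rwa [Matrix.mulVec_mulVec, ← Units.val_mul, mul_inv_cancel, Units.val_one,
        Matrix.one_mulVec] at h1
  refine ⟨C ((T.card : k)⁻¹) * ∑ g : G, matAct (g : Matrix.GeneralLinearGroup (Fin n) k) (s * F),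
    mul_mem ((invariants G).algebraMap_mem _) (sum_matAct_mem_invariants G _), ?_⟩
  have h2 := Ideal.sum_mem (ptIdeal v ^ N) (fun g (_ : g ∈ Finset.univ) => key g)
  rw [Finset.sum_sub_distrib, Finset.sum_ite_mem, Finset.univ_inter, Finset.sum_const,
    nsmul_eq_mul] at h2
  have h3 := Ideal.mul_mem_left _ (-C ((T.card : k)⁻¹)) h2
  have h4 : (C ((T.card : k)⁻¹) : MvPolynomial (Fin n) k) * (T.card : MvPolynomial (Fin n) k)
      = 1 := by
    rw [← map_natCast (C : k →+* MvPolynomial (Fin n) k), ← C_mul, inv_mul_cancel₀ hT, C_1]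
  convert! h3 using 1
  linear_combination (-F) * h4

/-- The invariants separate orbits. -/
lemma exists_mulVec_eq_of_pMap_eq [CharZero k] {n m : ℕ}
    {G : Subgroup (Matrix.GeneralLinearGroup (Fin n) k)} [Finite G]
    {p : Fin m → MvPolynomial (Fin n) k}
    (gen : Algebra.adjoin k (Set.range p) = invariants G) {x y : Fin n → k}
    (h : pMap p x = pMap p y) :
    ∃ g ∈ G, Matrix.mulVec (g : Matrix (Fin n) (Fin n) k) y = x := by
  classical
  have := Fintype.ofFinite G
  by_contra! hcon
  let S : Finset (Fin n → k) := Finset.univ.image fun g : G =>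
    Matrix.mulVec ((g : Matrix.GeneralLinearGroup (Fin n) k) : Matrix (Fin n) (Fin n) k) y
  have hS : x ∉ S := by
    intro hx
    obtain ⟨g, -, hg⟩ := Finset.mem_image.mp hx
    exact hcon g g.2 hg
  obtain ⟨s, hs1, hs2⟩ := exists_eval_one_zero x S hS
  let f := ∏ g : G, (1 - matAct (g : Matrix.GeneralLinearGroup (Fin n) k) s)
  have hf : f ∈ invariants G := by
    intro g hg
    simp only [f, map_prod]
    refine Fintype.prod_equiv (Equiv.mulLeft (⟨g, hg⟩ : G)) _ _ (fun a => ?_)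
    simp [matAct_mul]
  obtain ⟨u, hu⟩ := (mem_invariants_iff_exists gen).mp hf
  have h1 : eval x f = eval y f := by
    rw [← hu, eval_aeval, eval_aeval, h]
  have hx : eval x f = 0 := by
    simp only [f, map_prod]
    refine Finset.prod_eq_zero (Finset.mem_univ (1 : G)) ?_
    simp [matAct_one, hs1]
  have hy : eval y f = 1 := by
    simp only [f, map_prod]
    refine Finset.prod_eq_one fun g _ => ?_
    rw [map_sub, map_one, eval_matAct]
    have : eval (Matrix.mulVec (↑((g : Matrix.GeneralLinearGroup (Fin n) k)⁻¹) :
      Matrix (Fin n) (Fin n) k) y) s = 0 :=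
      hs2 _ (Finset.mem_image_of_mem _ (Finset.mem_univ g⁻¹))
    rw [this, sub_zero]
  rw [hx, hy] at h1
  exact zero_ne_one h1

lemma pMap_mulVec {n m : ℕ} {Wt G : Subgroup (Matrix.GeneralLinearGroup (Fin n) k)}
    {p : Fin m → MvPolynomial (Fin n) k} {d : Fin m → ℕ} {c : ↥Wt → Fin m → Fin m → k}
    (hs : QuotSetup Wt G p d c) (w : ↥Wt) (x : Fin n → k) :
    pMap p (Matrix.mulVec ((w : Matrix.GeneralLinearGroup (Fin n) k) : Matrix (Fin n) (Fin n) k) x)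
      = Matrix.mulVec (qMat c w) (pMap p x) := by
  funext i
  have h := congrArg (eval x) (hs.equivar w⁻¹ i)
  rw [eval_matAct] at h
  simpa [pMap, qMat, Matrix.mulVec, dotProduct] using h

lemma pMap_mulVec_of_mem {n m : ℕ} {G : Subgroup (Matrix.GeneralLinearGroup (Fin n) k)}
    {p : Fin m → MvPolynomial (Fin n) k}
    (gen : Algebra.adjoin k (Set.range p) = invariants G)
    {g : Matrix.GeneralLinearGroup (Fin n) k} (hg : g ∈ G) (x : Fin n → k) :
    pMap p (Matrix.mulVec (g : Matrix (Fin n) (Fin n) k) x) = pMap p x := by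
  funext i
  have hi : p i ∈ invariants G := gen ▸ Algebra.subset_adjoin ⟨i, rfl⟩
  have h := congrArg (eval x) (hi g⁻¹ (inv_mem hg))
  rw [eval_matAct, inv_inv] at h
  exact h

/-- The image of `Wt_L` in `W` is the pointwise stabilizer of `p(L)`. -/
lemma fixes_image_iff [CharZero k] {n m : ℕ}
    {Wt G : Subgroup (Matrix.GeneralLinearGroup (Fin n) k)}
    {p : Fin m → MvPolynomial (Fin n) k} {d : Fin m → ℕ} {c : ↥Wt → Fin m → Fin m → k}
    (hs : QuotSetup Wt G p d c) [Finite G] (L : Submodule k (Fin n → k)) (w : ↥Wt) :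
    (∀ x ∈ L, Matrix.mulVec (qMat c w) (pMap p x) = pMap p x)
      ↔ ∃ g ∈ G, ∃ u ∈ Wt ⊓ pointStab L,
          (w : Matrix.GeneralLinearGroup (Fin n) k) = g * u := by
  constructor
  · intro h
    obtain ⟨g, hg⟩ := exists_fixing_of_forall_exists (ι := G)
      (fun g => (((g : Matrix.GeneralLinearGroup (Fin n) k)⁻¹ * w :
        Matrix.GeneralLinearGroup (Fin n) k) : Matrix (Fin n) (Fin n) k)) L
      (fun x hx => by
        have h1 := h x hx
        rw [← pMap_mulVec hs] at h1
        obtain ⟨g, hg, hgx⟩ := exists_mulVec_eq_of_pMap_eq hs.gen h1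
        refine ⟨⟨g, hg⟩, ?_⟩
        rw [Units.val_mul, ← Matrix.mulVec_mulVec, ← hgx, Matrix.mulVec_mulVec,
          ← Units.val_mul, inv_mul_cancel, Units.val_one, Matrix.one_mulVec])
    exact ⟨g, g.2, _, ⟨Wt.mul_mem (Wt.inv_mem (hs.le g.2)) w.2, mem_pointStab.mpr hg⟩, by group⟩
  · rintro ⟨g, hg, u, hu, hw⟩ x hx
    rw [← pMap_mulVec hs, hw, Units.val_mul, ← Matrix.mulVec_mulVec,
      pMap_mulVec_of_mem hs.gen hg, hu.2 x hx]

/-- The first-order Taylor formula at `a`. -/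
lemma taylor_mem {m : ℕ} (a : Fin m → k) (f : MvPolynomial (Fin m) k) :
    f - C (eval a f) - ∑ i, C (eval a (pderiv i f)) * (X i - C (a i)) ∈ ptIdeal a ^ 2 := by
  have hX : ∀ i, (X i - C (a i) : MvPolynomial (Fin m) k) ∈ ptIdeal a := fun i => by
    rw [mem_ptIdeal]; simp
  induction f using MvPolynomial.induction_on with
  | C r => simp
  | add f g hf hg =>
    convert! add_mem hf hg using 1
    simp only [map_add, add_mul, Finset.sum_add_distrib]
    ring
  | mul_X f l hf =>
    have h1 : (∑ i, C (eval a (pderiv i f)) * (X i - C (a i))) * (X l - C (a l))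
        ∈ ptIdeal a ^ 2 := by
      rw [pow_two]
      exact Ideal.mul_mem_mul (Ideal.sum_mem _ fun i _ => Ideal.mul_mem_left _ _ (hX i)) (hX l)
    convert! add_mem (Ideal.mul_mem_right (X l) _ hf) h1 using 1
    have h2 : ∑ i, C (eval a (pderiv i (f * X l))) * (X i - C (a i) : MvPolynomial (Fin m) k)
        = C (a l) * (∑ i, C (eval a (pderiv i f)) * (X i - C (a i)))
          + C (eval a f) * (X l - C (a l)) := by
      have : ∀ i, C (eval a (pderiv i (f * X l))) * (X i - C (a i) : MvPolynomial (Fin m) k)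
          = C (a l) * (C (eval a (pderiv i f)) * (X i - C (a i)))
            + if i = l then C (eval a f) * (X i - C (a i)) else 0 := by
        intro i
        rw [pderiv_mul, pderiv_X]
        by_cases h : i = l
        · subst h
          simp only [Pi.single_eq_same, map_add, map_mul, eval_X, map_one, if_true]
          ring
        · rw [Pi.single_eq_of_ne (Ne.symm h)]
          simp only [map_mul, eval_X, mul_zero, add_zero, if_neg h]
          ring
      simp only [this, Finset.sum_add_distrib, Finset.mul_sum, Finset.sum_ite_eq',
        Finset.mem_univ, if_true]
    rw [h2]
    simp only [map_mul, eval_X]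
    ring

/-- The differential at `a`. -/
def diffAt {m : ℕ} (a : Fin m → k) : MvPolynomial (Fin m) k →ₗ[k] (Fin m → k) where
  toFun f i := eval a (pderiv i f)
  map_add' f g := by funext i; simp
  map_smul' r f := by funext i; simp

lemma diffAt_apply {m : ℕ} (a : Fin m → k) (f : MvPolynomial (Fin m) k) (i : Fin m) :
    diffAt a f i = eval a (pderiv i f) := rfl

lemma diffAt_mul {m : ℕ} (a : Fin m → k) (f g : MvPolynomial (Fin m) k) :
    diffAt a (f * g) = eval a g • diffAt a f + eval a f • diffAt a g := by
  funext i
  simp [diffAt_apply]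
  ring

lemma diffAt_eq_zero_of_mem_sq {m : ℕ} {a : Fin m → k} {f : MvPolynomial (Fin m) k}
    (hf : f ∈ ptIdeal a ^ 2) : diffAt a f = 0 := by
  rw [pow_two] at hf
  induction hf using Submodule.mul_induction_on' with
  | mem_mul_mem f hf g hg =>
    rw [diffAt_mul, mem_ptIdeal.mp hf, mem_ptIdeal.mp hg, zero_smul, zero_smul, add_zero]
  | add x _ y _ hx hy => rw [map_add, hx, hy, add_zero]

lemma sub_sum_diffAt_mem_sq {m : ℕ} {a : Fin m → k} {f : MvPolynomial (Fin m) k}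
    (hf : f ∈ ptIdeal a) : f - ∑ i, C (diffAt a f i) * (X i - C (a i)) ∈ ptIdeal a ^ 2 := by
  have := taylor_mem a f
  rwa [mem_ptIdeal.mp hf, C_0, sub_zero] at this

lemma mem_sq_of_diffAt_eq_zero {m : ℕ} {a : Fin m → k} {f : MvPolynomial (Fin m) k}
    (hf : f ∈ ptIdeal a) (h : diffAt a f = 0) : f ∈ ptIdeal a ^ 2 := by
  have := sub_sum_diffAt_mem_sq hf
  simpa [h] using this

lemma idealPlus_eq_ptIdeal (m : ℕ) : idealPlus k m = ptIdeal (0 : Fin m → k) := by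
  apply le_antisymm
  · rw [idealPlus, Ideal.span_le]
    rintro _ ⟨i, rfl⟩
    exact mem_ptIdeal.mpr (by simp)
  · intro f hf
    rw [mem_ptIdeal, eval_zero, constantCoeff_eq] at hf
    rw [idealPlus, ← Set.image_univ, mem_ideal_span_X_image]
    intro e he
    by_contra! hcon
    have : e = 0 := Finsupp.ext fun i => hcon i (Set.mem_univ i)
    subst this
    exact mem_support_iff.mp he hf

lemma mem_relIdeal {n m : ℕ} {p : Fin m → MvPolynomial (Fin n) k} {f : MvPolynomial (Fin m) k} :
    f ∈ relIdeal p ↔ aeval p f = 0 := Iff.rfl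

lemma relIdeal_le_ptIdeal {n m : ℕ} (p : Fin m → MvPolynomial (Fin n) k) (v : Fin n → k) :
    relIdeal p ≤ ptIdeal (pMap p v) := by
  intro f hf
  rw [mem_ptIdeal, ← eval_aeval, mem_relIdeal.mp hf, map_zero]

lemma pMap_zero {n m : ℕ} {p : Fin m → MvPolynomial (Fin n) k} {d : Fin m → ℕ}
    (homog : ∀ i, (p i).IsHomogeneous (d i)) (dpos : ∀ i, 0 < d i) :
    pMap p 0 = 0 := by
  funext i
  have := (homog i).coeff_eq_zero (d := 0) (by simpa using (dpos i).ne)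
  simpa [pMap, eval_zero, constantCoeff_eq] using this

/-- Minimality of the generators: relations have no linear part. -/
lemma relIdeal_le_sq {n m : ℕ} {Wt G : Subgroup (Matrix.GeneralLinearGroup (Fin n) k)}
    {p : Fin m → MvPolynomial (Fin n) k} {d : Fin m → ℕ} {c : ↥Wt → Fin m → Fin m → k}
    (hs : QuotSetup Wt G p d c) : relIdeal p ≤ ptIdeal (0 : Fin m → k) ^ 2 := by
  intro f hf
  have hp0 := pMap_zero hs.homog hs.dpos
  have hf0 : f ∈ ptIdeal (0 : Fin m → k) := hp0 ▸ relIdeal_le_ptIdeal p 0 hf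
  have hsq : ∀ q ∈ ptIdeal (0 : Fin m → k) ^ 2, aeval p q ∈ sqSpan G := by
    intro q hq
    rw [pow_two] at hq
    induction hq using Submodule.mul_induction_on' with
    | mem_mul_mem f hf g hg =>
      refine Submodule.subset_span ⟨aeval p f, (mem_invariants_iff_exists hs.gen).mpr ⟨f, rfl⟩,
        aeval p g, (mem_invariants_iff_exists hs.gen).mpr ⟨g, rfl⟩, ?_, ?_, map_mul _ _ _⟩
      · rw [← eval_zero, eval_aeval, hp0, mem_ptIdeal.mp hf]
      · rw [← eval_zero, eval_aeval, hp0, mem_ptIdeal.mp hg]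
    | add x _ y _ hx hy => rw [map_add]; exact add_mem hx hy
  refine mem_sq_of_diffAt_eq_zero hf0 (hs.minimal _ ?_)
  have h1 := neg_mem (hsq _ (sub_sum_diffAt_mem_sq hf0))
  rw [map_sub, mem_relIdeal.mp hf, zero_sub, neg_neg, map_sum] at h1
  simpa [← smul_eq_C_mul] using h1

lemma le_of_relIdeal_eq_bot {n m : ℕ} {p : Fin m → MvPolynomial (Fin n) k}
    (h : relIdeal p = ⊥) : m ≤ n := by
  have h1 : AlgebraicIndependent k p := by
    rw [AlgebraicIndependent]
    exact (RingHom.injective_iff_ker_eq_bot _).mpr h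
  have h2 := h1.cardinalMk_le_trdeg
  simpa using h2

/-- A morphism `φ : k[V] → k[V']` of presentations of two algebras `k[V]/I` and `k[V']/I'`
which identifies their completions at `a` and at `0`. -/
structure LocalIso {m m' : ℕ} (φ : MvPolynomial (Fin m) k →ₐ[k] MvPolynomial (Fin m') k)
    (a : Fin m → k) (I : Ideal (MvPolynomial (Fin m) k)) (I' : Ideal (MvPolynomial (Fin m') k)) :
    Prop where
  eval_zero' : ∀ f, eval 0 (φ f) = eval a f
  le_sq : I' ≤ ptIdeal (0 : Fin m' → k) ^ 2
  le_pt : I ≤ ptIdeal a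
  map_mem : ∀ f ∈ I, φ f ∈ I'
  approx : ∀ y, ∃ u, y - φ u ∈ ptIdeal (0 : Fin m' → k) ^ 2
  order : ∀ j, ∃ N, ∀ f, ∀ z ∈ ptIdeal (0 : Fin m' → k) ^ N, φ f - z ∈ I' → f ∈ ptIdeal a ^ j ⊔ I

namespace LocalIso

variable {m m' : ℕ} {φ : MvPolynomial (Fin m) k →ₐ[k] MvPolynomial (Fin m') k}
  {a : Fin m → k} {I : Ideal (MvPolynomial (Fin m) k)} {I' : Ideal (MvPolynomial (Fin m') k)}

lemma map_ptIdeal (h : LocalIso φ a I I') {f : MvPolynomial (Fin m) k} :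
    φ f ∈ ptIdeal (0 : Fin m' → k) ↔ f ∈ ptIdeal a := by
  rw [mem_ptIdeal, mem_ptIdeal, h.eval_zero']

lemma map_pow (h : LocalIso φ a I I') {f : MvPolynomial (Fin m) k} {N : ℕ}
    (hf : f ∈ ptIdeal a ^ N) : φ f ∈ ptIdeal (0 : Fin m' → k) ^ N :=
  mem_pow_of_map_mem φ (fun _ hf => h.map_ptIdeal.mpr hf) hf

lemma exists_approx_succ (h : LocalIso φ a I I') (N : ℕ) :
    ∀ z ∈ ptIdeal (0 : Fin m' → k) ^ (N + 1), ∃ f ∈ ptIdeal a ^ (N + 1),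
      z - φ f ∈ ptIdeal (0 : Fin m' → k) ^ (N + 2) := by
  have base : ∀ z ∈ ptIdeal (0 : Fin m' → k), ∃ f ∈ ptIdeal a,
      z - φ f ∈ ptIdeal (0 : Fin m' → k) ^ 2 := by
    intro z hz
    obtain ⟨u, hu⟩ := h.approx z
    refine ⟨u, h.map_ptIdeal.mp ?_, hu⟩
    have := sub_mem hz (Ideal.pow_le_self two_ne_zero hu)
    rwa [sub_sub_cancel] at this
  induction N with
  | zero =>
    simpa using base
  | succ N ih =>
    intro z hz
    rw [pow_succ] at hz
    induction hz using Submodule.mul_induction_on' with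
    | mem_mul_mem x hx y hy =>
      obtain ⟨f, hf, hf'⟩ := ih x hx
      obtain ⟨g, hg, hg'⟩ := base y hy
      refine ⟨f * g, ?_, ?_⟩
      · rw [pow_succ]; exact Ideal.mul_mem_mul hf hg
      · have e : x * y - φ (f * g) = (x - φ f) * y + φ f * (y - φ g) := by
          rw [map_mul]; ring
        rw [e]
        refine add_mem ?_ ?_
        · rw [pow_succ]; exact Ideal.mul_mem_mul hf' hy
        · have := Ideal.mul_mem_mul (h.map_pow hf) hg'
          rwa [← pow_add] at this
    | add x _ y _ hx hy =>
      obtain ⟨f, hf, hf'⟩ := hx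
      obtain ⟨g, hg, hg'⟩ := hy
      refine ⟨f + g, add_mem hf hg, ?_⟩
      have := add_mem hf' hg'
      rw [map_add]
      convert! this using 1
      ring

lemma exists_approx (h : LocalIso φ a I I') {z : MvPolynomial (Fin m') k}
    (hz : z ∈ ptIdeal (0 : Fin m' → k) ^ 2) (N : ℕ) :
    ∃ f ∈ ptIdeal a ^ 2, z - φ f ∈ ptIdeal (0 : Fin m' → k) ^ (N + 2) := by
  induction N with
  | zero => exact ⟨0, zero_mem _, by simpa using hz⟩
  | succ N ih =>
    obtain ⟨f, hf, hf'⟩ := ih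
    obtain ⟨g, hg, hg'⟩ := h.exists_approx_succ (N + 1) _ hf'
    refine ⟨f + g, add_mem hf (Ideal.pow_le_pow_right (by omega) hg), ?_⟩
    rw [map_add, ← sub_sub]
    exact hg'

/-- On cotangent spaces `φ` is injective modulo `I`. -/
lemma mem_sup_of_map_mem_sq (h : LocalIso φ a I I') {f : MvPolynomial (Fin m) k}
    (hf : φ f ∈ ptIdeal (0 : Fin m' → k) ^ 2) : f ∈ ptIdeal a ^ 2 ⊔ I := by
  obtain ⟨N, hN⟩ := h.order 2
  obtain ⟨g, hg, hg'⟩ := h.exists_approx hf N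
  have h1 := hN (f - g) (φ f - φ g) (Ideal.pow_le_pow_right (by omega) hg')
    (by rw [map_sub, sub_self]; exact zero_mem _)
  have := add_mem h1 (Submodule.mem_sup_left hg : g ∈ ptIdeal a ^ 2 ⊔ I)
  rwa [sub_add_cancel] at this

/-- Modulo `m' I'`, the relations `I'` come from the relations in `I` without linear part. -/
lemma exists_sub_map_mem (h : LocalIso φ a I I') {g : MvPolynomial (Fin m') k} (hg : g ∈ I') :
    ∃ f ∈ I, f ∈ ptIdeal a ^ 2 ∧ g - φ f ∈ ptIdeal (0 : Fin m' → k) * I' := by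
  obtain ⟨r, hr⟩ := Ideal.exists_pow_inf_eq_pow_smul (ptIdeal (0 : Fin m' → k)) I'
  have hAR : ∀ z, z ∈ ptIdeal (0 : Fin m' → k) ^ (r + 2) → z ∈ I' →
      z ∈ ptIdeal (0 : Fin m' → k) * I' := by
    intro z hz hz'
    have h1 : z ∈ ptIdeal (0 : Fin m' → k) ^ (r + 1) • (⊤ : Ideal (MvPolynomial (Fin m') k))
        ⊓ I' := by
      refine ⟨?_, hz'⟩
      rw [smul_eq_mul, Ideal.mul_top]
      exact Ideal.pow_le_pow_right (by omega) hz
    rw [hr _ (by omega), Nat.add_sub_cancel_left, pow_one, smul_eq_mul] at h1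
    exact Ideal.mul_mono_right inf_le_right h1
  obtain ⟨N, hN⟩ := h.order (r + 2)
  obtain ⟨f, hf, hf'⟩ := h.exists_approx (h.le_sq hg) (r + N)
  have h1 := hN f (-(g - φ f)) (neg_mem (Ideal.pow_le_pow_right (by omega) hf'))
    (by rwa [sub_neg_eq_add, add_sub_cancel])
  obtain ⟨f2, hf2, f1, hf1, hsum⟩ := Submodule.mem_sup.mp h1
  refine ⟨f1, hf1, ?_, hAR _ ?_ (sub_mem hg (h.map_mem _ hf1))⟩
  · have : f1 = f - f2 := by rw [← hsum, add_sub_cancel_left]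
    rw [this]
    exact sub_mem hf (Ideal.pow_le_pow_right (by omega) hf2)
  · have : g - φ f1 = (g - φ f) + φ f2 := by rw [← hsum, map_add]; ring
    rw [this]
    exact add_mem (Ideal.pow_le_pow_right (by omega) hf') (h.map_pow hf2)

/-- Bound on the number of generators of `I'` at the origin. -/
lemma exists_finrank_le (h : LocalIso φ a I I') (s : Finset (MvPolynomial (Fin m) k))
    (hs : Ideal.span (s : Set (MvPolynomial (Fin m) k)) = I) :
    ∃ W : Submodule k (MvPolynomial (Fin m') k), Module.Finite k W ∧
      Module.finrank k W ≤ s.card - (m - m') ∧ (∀ w ∈ W, w ∈ I') ∧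
      ∀ g ∈ I', ∃ w ∈ W, g - w ∈ ptIdeal (0 : Fin m' → k) * I' := by
  classical
  have hsI : ∀ b : s, (b : MvPolynomial (Fin m) k) ∈ I := fun b => hs ▸ Ideal.subset_span b.2
  have hsa : ∀ b : s, eval a (b : MvPolynomial (Fin m) k) = 0 := fun b => h.le_pt (hsI b)
  let comb : (s → k) →ₗ[k] MvPolynomial (Fin m) k :=
    Fintype.linearCombination k (fun b : s => (b : MvPolynomial (Fin m) k))
  have comb_apply : ∀ e, comb e = ∑ b : s, e b • (b : MvPolynomial (Fin m) k) := fun e =>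
    Fintype.linearCombination_apply _ _ _
  have comb_mem : ∀ e, comb e ∈ I := fun e => by
    rw [comb_apply]
    exact Ideal.sum_mem _ fun b _ => by
      rw [smul_eq_C_mul]; exact Ideal.mul_mem_left _ _ (hsI b)
  let E : (s → k) →ₗ[k] (Fin m → k) := (diffAt a).comp comb
  have hcong : ∀ f ∈ I, ∃ e : s → k, f - comb e ∈ ptIdeal a * I := by
    intro f hf
    rw [← hs] at hf
    obtain ⟨q, -, hq⟩ := Submodule.mem_span_finset.mp hf
    refine ⟨fun b => eval a (q b), ?_⟩
    have e : f - comb (fun b : s => eval a (q b))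
        = ∑ b : s, (q b - C (eval a (q b))) * (b : MvPolynomial (Fin m) k) := by
      rw [comb_apply, ← hq, ← Finset.sum_coe_sort s, ← Finset.sum_sub_distrib]
      refine Finset.sum_congr rfl fun b _ => ?_
      rw [smul_eq_mul, smul_eq_C_mul, sub_mul]
    rw [e]
    refine Ideal.sum_mem _ fun b _ => Ideal.mul_mem_mul ?_ (hsI b)
    rw [mem_ptIdeal]; simp
  have hmulsq : ptIdeal a * I ≤ ptIdeal a ^ 2 := by
    rw [pow_two]; exact Ideal.mul_mono_right h.le_pt
  have hrange : ∀ f ∈ I, diffAt a f ∈ LinearMap.range E := by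
    intro f hf
    obtain ⟨e, he⟩ := hcong f hf
    refine ⟨e, ?_⟩
    have := diffAt_eq_zero_of_mem_sq (hmulsq he)
    rw [map_sub, sub_eq_zero] at this
    exact this.symm
  let lin : (Fin m → k) →ₗ[k] MvPolynomial (Fin m) k :=
    Fintype.linearCombination k (fun i => X i - C (a i))
  have lin_apply : ∀ u, lin u = ∑ i, u i • (X i - C (a i) : MvPolynomial (Fin m) k) := fun u =>
    Fintype.linearCombination_apply _ _ _
  have lin_mem : ∀ u, lin u ∈ ptIdeal a := fun u => by
    rw [mem_ptIdeal, lin_apply, map_sum]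
    exact Finset.sum_eq_zero fun i _ => by simp
  have diff_lin : ∀ u, diffAt a (lin u) = u := fun u => by
    funext i
    rw [diffAt_apply, lin_apply, map_sum, map_sum, Finset.sum_eq_single i]
    · simp
    · intro b _ hb
      simp [pderiv_X_of_ne hb]
    · simp
  let T : (Fin m → k) →ₗ[k] (Fin m' → k) := (diffAt 0).comp (φ.toLinearMap.comp lin)
  have hker : LinearMap.ker T ≤ LinearMap.range E := by
    intro u hu
    have h1 : φ (lin u) ∈ ptIdeal (0 : Fin m' → k) ^ 2 :=
      mem_sq_of_diffAt_eq_zero (h.map_ptIdeal.mpr (lin_mem u)) hu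
    obtain ⟨f2, hf2, f1, hf1, hsum⟩ := Submodule.mem_sup.mp (h.mem_sup_of_map_mem_sq h1)
    have h2 := hrange f1 hf1
    have h3 := diff_lin u
    rw [← hsum, map_add, diffAt_eq_zero_of_mem_sq hf2, zero_add] at h3
    rwa [h3] at h2
  let P : (s → k) →ₗ[k] MvPolynomial (Fin m') k := φ.toLinearMap.comp comb
  refine ⟨(LinearMap.ker E).map P, inferInstance, ?_, ?_, ?_⟩
  · have h1 := LinearMap.finrank_range_add_finrank_ker E
    have h2 := LinearMap.finrank_range_add_finrank_ker T
    have h3 := Submodule.finrank_mono hker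
    have h4 := Submodule.finrank_le (LinearMap.range T)
    have h5 := Submodule.finrank_map_le P (LinearMap.ker E)
    simp only [Module.finrank_fintype_fun_eq_card, Fintype.card_coe, Fintype.card_fin] at h1 h2 h4
    omega
  · rintro _ ⟨e, -, rfl⟩
    exact h.map_mem _ (comb_mem e)
  · intro g hg
    obtain ⟨f, hf, hf2, hgf⟩ := h.exists_sub_map_mem hg
    obtain ⟨e, he⟩ := hcong f hf
    refine ⟨P e, ⟨e, ?_, rfl⟩, ?_⟩
    · have h1 := sub_mem hf2 (hmulsq he)
      rw [sub_sub_cancel] at h1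
      exact diffAt_eq_zero_of_mem_sq h1
    · have h1 : φ (f - comb e) ∈ ptIdeal (0 : Fin m' → k) * I' := by
        have h2 := Ideal.mem_map_of_mem φ he
        rw [Ideal.map_mul] at h2
        refine Ideal.mul_mono ?_ ?_ h2
        · exact Ideal.map_le_iff_le_comap.mpr fun x hx => h.map_ptIdeal.mpr hx
        · exact Ideal.map_le_iff_le_comap.mpr h.map_mem
      have h3 := add_mem hgf h1
      rw [map_sub] at h3
      convert! h3 using 1
      simp [P]

end LocalIso

lemma sum_components_mem {m : ℕ} (d : Fin m → ℕ) {S : Submodule k (MvPolynomial (Fin m) k)}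
    {f : MvPolynomial (Fin m) k} (h : ∀ e, weightedHomogeneousComponent d e f ∈ S) : f ∈ S := by
  rw [← finsum_weightedHomogeneousComponent d f]
  exact finsum_induction (· ∈ S) (zero_mem S) (fun _ _ => add_mem) h

lemma degree_le_weight {m : ℕ} {d : Fin m → ℕ} (dpos : ∀ i, 0 < d i) (t : Fin m →₀ ℕ) :
    Finsupp.degree t ≤ Finsupp.weight d t := by
  rw [Finsupp.weight_apply, Finsupp.sum, Finsupp.degree_apply]
  exact Finset.sum_le_sum fun i _ => Nat.le_mul_of_pos_right _ (dpos i)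

lemma weightedHomogeneousComponent_of_mem_pow {m : ℕ} {d : Fin m → ℕ} (dpos : ∀ i, 0 < d i)
    {N e : ℕ} (he : e < N) {f : MvPolynomial (Fin m) k} (hf : f ∈ idealPlus k m ^ N) :
    weightedHomogeneousComponent d e f = 0 := by
  ext t
  rw [coeff_weightedHomogeneousComponent, coeff_zero]
  split_ifs with ht
  · refine (mem_pow_idealOfVars_iff' N f).mp hf t ?_
    have := degree_le_weight dpos t
    omega
  · rfl

/-- Graded Nakayama lemma for ideals of a positively graded polynomial ring. -/
lemma le_of_le_sup_idealPlus_mul {m : ℕ} {d : Fin m → ℕ} (dpos : ∀ i, 0 < d i)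
    {I J : Ideal (MvPolynomial (Fin m) k)}
    (hJ : ∀ f ∈ J, ∀ e, weightedHomogeneousComponent d e f ∈ J)
    (h : I ≤ J ⊔ idealPlus k m * I) : I ≤ J := by
  have key : ∀ N, I ≤ J ⊔ idealPlus k m ^ N := by
    intro N
    induction N with
    | zero => simp
    | succ N ih =>
      refine h.trans (sup_le le_sup_left ?_)
      refine (Ideal.mul_mono_right ih).trans ?_
      rw [Ideal.mul_sup, pow_succ']
      exact sup_le_sup_right Ideal.mul_le_right _
  intro f hf
  change f ∈ J.restrictScalars k
  refine sum_components_mem d fun e => ?_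
  obtain ⟨j, hj, z, hz, rfl⟩ := Submodule.mem_sup.mp (key (e + 1) hf)
  rw [map_add, weightedHomogeneousComponent_of_mem_pow dpos e.lt_succ_self hz, add_zero]
  exact hJ j hj e

lemma component_mem_span {m : ℕ} {d : Fin m → ℕ} {S : Set (MvPolynomial (Fin m) k)}
    (hS : ∀ f ∈ S, ∃ e, IsWeightedHomogeneous d f e) {f : MvPolynomial (Fin m) k}
    (hf : f ∈ Ideal.span S) (e : ℕ) : weightedHomogeneousComponent d e f ∈ Ideal.span S := by
  let _ := weightedGradedAlgebra k d
  exact weightedHomogeneousComponent_mem_of_mem k d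
    (Ideal.homogeneous_span (weightedHomogeneousSubmodule k d) S hS) hf e

lemma component_aeval {m n : ℕ} {d : Fin m → ℕ} {δ : Fin n → ℕ}
    {q : Fin m → MvPolynomial (Fin n) k} (hq : ∀ i, IsWeightedHomogeneous δ (q i) (d i))
    (f : MvPolynomial (Fin m) k) (e : ℕ) :
    weightedHomogeneousComponent δ e (aeval q f)
      = aeval q (weightedHomogeneousComponent d e f) := by
  induction f using MvPolynomial.induction_on' with
  | monomial t r =>
    have h1 : IsWeightedHomogeneous d (monomial t r) (Finsupp.weight d t) :=
      isWeightedHomogeneous_monomial d t r rfl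
    have h2 : IsWeightedHomogeneous δ (aeval q (monomial t r)) (Finsupp.weight d t) := by
      rw [aeval_monomial, algebraMap_eq, Finsupp.weight_apply]
      exact (IsWeightedHomogeneous.prod _ _ _ fun i _ => (hq i).pow _).C_mul r
    rw [weightedHomogeneousComponent_of_mem h1, weightedHomogeneousComponent_of_mem h2]
    split_ifs <;> simp
  | add f g hf hg => simp only [map_add, hf, hg]

lemma isHomogeneous_matAct {n e : ℕ} (g : Matrix.GeneralLinearGroup (Fin n) k)
    {f : MvPolynomial (Fin n) k} (hf : f.IsHomogeneous e) : (matAct g f).IsHomogeneous e := by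
  have hq : ∀ i, IsWeightedHomogeneous (1 : Fin n → ℕ)
      (∑ j, ((↑(g⁻¹) : Matrix (Fin n) (Fin n) k) i j) • (X j : MvPolynomial (Fin n) k))
      ((1 : Fin n → ℕ) i) := fun i => by
    refine IsWeightedHomogeneous.sum _ _ _ fun j _ => ?_
    rw [smul_eq_C_mul]
    exact (isWeightedHomogeneous_X k 1 j).C_mul _
  have h := component_aeval hq f e
  rw [weightedHomogeneousComponent_eq_self hf] at h
  change IsWeightedHomogeneous 1 (aeval _ f) e
  rw [← h]
  exact weightedHomogeneousComponent_mem _ _ _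

lemma component_mem_relIdeal {n m : ℕ} {p : Fin m → MvPolynomial (Fin n) k} {d : Fin m → ℕ}
    (homog : ∀ i, (p i).IsHomogeneous (d i)) {f : MvPolynomial (Fin m) k} (hf : f ∈ relIdeal p)
    (e : ℕ) : weightedHomogeneousComponent d e f ∈ relIdeal p := by
  rw [mem_relIdeal] at *
  rw [← component_aeval (δ := 1) homog, hf, map_zero]

namespace QuotSetup

variable {n m : ℕ} {Wt G : Subgroup (Matrix.GeneralLinearGroup (Fin n) k)}
  {p : Fin m → MvPolynomial (Fin n) k} {d : Fin m → ℕ} {c : ↥Wt → Fin m → Fin m → k}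

lemma sum_smul_injective (hs : QuotSetup Wt G p d c) {a b : Fin m → k}
    (h : ∑ i, a i • p i = ∑ i, b i • p i) : a = b := by
  refine sub_eq_zero.mp (hs.minimal (a - b) ?_)
  simp only [Pi.sub_apply, sub_smul, Finset.sum_sub_distrib, h, sub_self]
  exact zero_mem _

lemma eq_zero_of_ne (hs : QuotSetup Wt G p d c) (w : ↥Wt) {i j : Fin m} (hij : d j ≠ d i) :
    c w i j = 0 := by
  have h1 := isHomogeneous_matAct (w : Matrix.GeneralLinearGroup (Fin n) k) (hs.homog i)
  have h2 := weightedHomogeneousComponent_eq_self h1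
  rw [hs.equivar, map_sum] at h2
  have h3 : ∑ j, c w i j • p j = ∑ j, (if d i = d j then c w i j else 0) • p j := by
    rw [← h2]
    refine Finset.sum_congr rfl fun l _ => ?_
    rw [map_smul, weightedHomogeneousComponent_of_mem (hs.homog l)]
    split_ifs <;> simp
  have h4 := congrFun (hs.sum_smul_injective h3) j
  rwa [if_neg (Ne.symm hij)] at h4

lemma component_polyAct (hs : QuotSetup Wt G p d c) (w : ↥Wt) (f : MvPolynomial (Fin m) k)
    (e : ℕ) : weightedHomogeneousComponent d e (polyAct (c w) f)
      = polyAct (c w) (weightedHomogeneousComponent d e f) := by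
  refine component_aeval (fun i => IsWeightedHomogeneous.sum _ _ _ fun j _ => ?_) f e
  by_cases hij : d j = d i
  · rw [smul_eq_C_mul, ← hij]
    exact (isWeightedHomogeneous_X k d j).C_mul _
  · rw [hs.eq_zero_of_ne w hij, zero_smul]
    exact isWeightedHomogeneous_zero k d _

lemma aeval_polyAct (hs : QuotSetup Wt G p d c) (w : ↥Wt) (f : MvPolynomial (Fin m) k) :
    aeval p (polyAct (c w) f)
      = matAct (w : Matrix.GeneralLinearGroup (Fin n) k) (aeval p f) := by
  have h : (aeval p).comp (polyAct (c w))
      = (matAct (w : Matrix.GeneralLinearGroup (Fin n) k)).comp (aeval p) := by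
    apply MvPolynomial.algHom_ext
    intro i
    simp [polyAct, hs.equivar]
  exact DFunLike.congr_fun h f

lemma polyAct_mem_relIdeal (hs : QuotSetup Wt G p d c) (w : ↥Wt) {f : MvPolynomial (Fin m) k}
    (hf : f ∈ relIdeal p) : polyAct (c w) f ∈ relIdeal p := by
  rw [mem_relIdeal] at *
  rw [hs.aeval_polyAct, hf, map_zero]

lemma polyAct_mul (hs : QuotSetup Wt G p d c) (w w' : ↥Wt) (f : MvPolynomial (Fin m) k) :
    polyAct (c (w * w')) f = polyAct (c w) (polyAct (c w') f) := by
  have h : polyAct (c (w * w')) = (polyAct (c w)).comp (polyAct (c w')) := by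
    apply MvPolynomial.algHom_ext
    intro i
    have h1 := hs.equivar (w * w') i
    rw [Subgroup.coe_mul, matAct_mul, hs.equivar w' i] at h1
    simp only [map_sum, map_smul, hs.equivar w, Finset.smul_sum, smul_smul] at h1
    rw [Finset.sum_comm] at h1
    simp only [← Finset.sum_smul] at h1
    have h2 := hs.sum_smul_injective h1
    simp only [polyAct, AlgHom.coe_comp, Function.comp_apply, aeval_X, map_sum, map_smul,
      Finset.smul_sum, smul_smul]
    rw [Finset.sum_comm, ← h2]
    simp only [Finset.sum_smul]
  exact DFunLike.congr_fun h f

/-- If `W` acts trivially on `I / A_+ I`, then `I` is generated by `W`-invariants. -/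
lemma relIdeal_le_span [CharZero k] (hs : QuotSetup Wt G p d c) (ht : TrivialConormal Wt p c) :
    relIdeal p ≤ Ideal.span {f | f ∈ relIdeal p ∧ ∀ w, polyAct (c w) f = f} := by
  have := hs.finite.to_subtype
  have := Fintype.ofFinite (↥Wt)
  set S : Set (MvPolynomial (Fin m) k) := {f | f ∈ relIdeal p ∧ ∀ w, polyAct (c w) f = f}
  have hS : ∀ f ∈ S, ∀ e, weightedHomogeneousComponent d e f ∈ S := fun f hf e =>
    ⟨component_mem_relIdeal hs.homog hf.1 e, fun w => by rw [← hs.component_polyAct, hf.2 w]⟩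
  let S' : Set (MvPolynomial (Fin m) k) := {f | f ∈ S ∧ ∃ e, IsWeightedHomogeneous d f e}
  refine le_trans ?_ (Ideal.span_mono (s := S') fun f hf => hf.1)
  refine le_of_le_sup_idealPlus_mul hs.dpos
    (fun f hf e => component_mem_span (fun g hg => hg.2) hf e) fun f hf => ?_
  have hc : (Fintype.card Wt : k) ≠ 0 := Nat.cast_ne_zero.mpr Fintype.card_ne_zero
  let g := (Fintype.card Wt : k)⁻¹ • ∑ w, polyAct (c w) f
  have hg : g ∈ S := by
    refine ⟨?_, fun w => ?_⟩
    · change g ∈ (relIdeal p).restrictScalars k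
      exact Submodule.smul_mem _ _ (sum_mem fun w _ => hs.polyAct_mem_relIdeal w hf)
    · rw [map_smul, map_sum]
      congr 1
      exact Fintype.sum_equiv (Equiv.mulLeft w) _ _ fun u => (hs.polyAct_mul w u f).symm
  have hfg : g - f ∈ idealPlus k m * relIdeal p := by
    have e : g - f = (Fintype.card Wt : k)⁻¹ • ∑ w, (polyAct (c w) f - f) := by
      rw [Finset.sum_sub_distrib, smul_sub, Finset.sum_const, Finset.card_univ,
        ← Nat.cast_smul_eq_nsmul k, smul_smul, inv_mul_cancel₀ hc, one_smul]
    rw [e]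
    change _ ∈ (idealPlus k m * relIdeal p).restrictScalars k
    exact Submodule.smul_mem _ _ (sum_mem fun w _ => ht w f hf)
  have hgJ : g ∈ Ideal.span S' := by
    change g ∈ (Ideal.span S').restrictScalars k
    exact sum_components_mem d fun e => Ideal.subset_span
      ⟨hS g hg e, e, weightedHomogeneousComponent_mem d g e⟩
  rw [← sub_sub_cancel g f]
  exact sub_mem (Submodule.mem_sup_left hgJ) (Submodule.mem_sup_right hfg)

lemma eval_polyAct (hs : QuotSetup Wt G p d c) (w : ↥Wt) {v : Fin n → k}
    (hv : Matrix.mulVec (((w : Matrix.GeneralLinearGroup (Fin n) k)) : Matrix (Fin n) (Fin n) k) v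
      = v) (f : MvPolynomial (Fin m) k) :
    eval (pMap p v) (polyAct (c w) f) = eval (pMap p v) f := by
  have hv' : Matrix.mulVec
      (↑((w : Matrix.GeneralLinearGroup (Fin n) k)⁻¹) : Matrix (Fin n) (Fin n) k) v = v := by
    nth_rewrite 1 [← hv]
    rw [Matrix.mulVec_mulVec, ← Units.val_mul, inv_mul_cancel, Units.val_one, Matrix.one_mulVec]
  have h : (eval (pMap p v)).comp (polyAct (c w)).toRingHom = eval (pMap p v) := by
    apply MvPolynomial.ringHom_ext
    · intro r; simp
    · intro i
      have h1 := congrArg (eval v) (hs.equivar w i)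
      rw [eval_matAct, hv', map_sum] at h1
      simpa [polyAct, pMap, smul_eval] using h1.symm
  exact congrArg (fun φ => φ f) h

lemma polyAct_sub_mem [CharZero k] (hs : QuotSetup Wt G p d c) (ht : TrivialConormal Wt p c)
    (w : ↥Wt) {v : Fin n → k}
    (hv : Matrix.mulVec (((w : Matrix.GeneralLinearGroup (Fin n) k)) : Matrix (Fin n) (Fin n) k) v
      = v) {f : MvPolynomial (Fin m) k} (hf : f ∈ relIdeal p) :
    polyAct (c w) f - f ∈ ptIdeal (pMap p v) * relIdeal p := by
  refine Submodule.span_induction ?_ ?_ ?_ ?_ (hs.relIdeal_le_span ht hf)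
  · rintro f ⟨-, hf⟩
    rw [hf w, sub_self]
    exact zero_mem _
  · simp
  · intro f g _ _ hf hg
    rw [map_add, add_sub_add_comm]
    exact add_mem hf hg
  · intro r f hf' hf
    have hfI : f ∈ relIdeal p := by
      refine Ideal.span_le.mpr ?_ hf'
      exact fun g hg => hg.1
    have e : polyAct (c w) (r • f) - r • f
        = polyAct (c w) r * (polyAct (c w) f - f) + (polyAct (c w) r - r) * f := by
      rw [smul_eq_mul, map_mul]; ring
    rw [e]
    refine add_mem (Ideal.mul_mem_left _ _ hf) (Ideal.mul_mem_mul ?_ hfI)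
    rw [mem_ptIdeal, map_sub, hs.eval_polyAct w hv, sub_self]

end QuotSetup

/-- A graded ideal is generated by as many elements as are needed modulo `A_+ I`. -/
lemma exists_generators_of_finrank {m : ℕ} {d : Fin m → ℕ} (dpos : ∀ i, 0 < d i)
    {I : Ideal (MvPolynomial (Fin m) k)} (hI : ∀ f ∈ I, ∀ e, weightedHomogeneousComponent d e f ∈ I)
    (W : Submodule k (MvPolynomial (Fin m) k)) [Module.Finite k W]
    (hW : ∀ g ∈ I, ∃ w ∈ W, g - w ∈ idealPlus k m * I) :
    ∃ s : Finset (MvPolynomial (Fin m) k), s.card ≤ Module.finrank k W ∧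
      Ideal.span (s : Set (MvPolynomial (Fin m) k)) = I := by
  classical
  let N : Submodule k (MvPolynomial (Fin m) k) := (idealPlus k m * I).restrictScalars k
  let H : Set (MvPolynomial (Fin m) k) := {f | f ∈ I ∧ ∃ e, IsWeightedHomogeneous d f e}
  have hTW : Submodule.span k (N.mkQ '' H) ≤ W.map N.mkQ := by
    rw [Submodule.span_le]
    rintro _ ⟨f, hf, rfl⟩
    obtain ⟨w, hw, hfw⟩ := hW f hf.1
    exact ⟨w, hw, ((Submodule.Quotient.eq N).mpr hfw).symm⟩
  have : Module.Finite k (Submodule.span k (N.mkQ '' H)) :=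
    Submodule.finiteDimensional_of_le hTW
  obtain ⟨t, htT, htcard, htspan, -⟩ := Submodule.exists_finset_span_eq_linearIndepOn k (N.mkQ '' H)
  have hlift : ∀ x : t, ∃ f ∈ H, N.mkQ f = x := fun x => htT x.2
  choose l hlH hl using hlift
  let s : Finset (MvPolynomial (Fin m) k) := Finset.univ.image l
  have hst : N.mkQ '' (s : Set (MvPolynomial (Fin m) k)) = t := by
    rw [Finset.coe_image, Finset.coe_univ, Set.image_univ, ← Set.range_comp]
    convert! Subtype.range_coe using 2
    exact funext hl
  have hsH' : ∀ f ∈ s, f ∈ H := fun f hf => by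
    obtain ⟨x, -, rfl⟩ := Finset.mem_image.mp hf
    exact hlH x
  refine ⟨s, ?_, le_antisymm (Ideal.span_le.mpr fun f hf => (hsH' f hf).1) ?_⟩
  · refine Finset.card_image_le.trans ?_
    rw [Finset.card_univ, Fintype.card_coe, htcard]
    exact (Submodule.finrank_mono hTW).trans (Submodule.finrank_map_le _ _)
  refine le_of_le_sup_idealPlus_mul dpos
    (fun f hf e => component_mem_span (fun g hg => (hsH' g hg).2) hf e) fun f hf => ?_
  have h1 : f ∈ (Submodule.span k (N.mkQ '' H)).comap N.mkQ :=
    sum_components_mem d fun e => Submodule.subset_span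
      ⟨_, ⟨hI f hf e, e, weightedHomogeneousComponent_mem d f e⟩, rfl⟩
  rw [← htspan, ← hst, ← Submodule.map_span] at h1
  obtain ⟨g, hg, hgf⟩ := h1
  have h2 : f - g ∈ idealPlus k m * I := (Submodule.Quotient.eq N).mp hgf.symm
  have h3 : g ∈ Ideal.span (s : Set (MvPolynomial (Fin m) k)) :=
    Submodule.span_le_restrictScalars k _ _ hg
  rw [← sub_add_cancel f g, add_comm]
  exact add_mem (Submodule.mem_sup_left h3) (Submodule.mem_sup_right h2)

lemma exists_generators_card_eq [CharZero k] {m r : ℕ} {I : Ideal (MvPolynomial (Fin m) k)}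
    {s : Finset (MvPolynomial (Fin m) k)} (hcard : s.card ≤ r)
    (hs : Ideal.span (s : Set (MvPolynomial (Fin m) k)) = I) (hbot : I = ⊥ → r = 0) :
    ∃ s : Finset (MvPolynomial (Fin m) k), s.card = r ∧
      Ideal.span (s : Set (MvPolynomial (Fin m) k)) = I := by
  classical
  by_cases hI : I = ⊥
  · exact ⟨∅, by simp [hbot hI], by simp [hI]⟩
  obtain ⟨f, hf, hf0⟩ := Submodule.exists_mem_ne_zero_of_ne_bot hI
  have hinf : (I : Set (MvPolynomial (Fin m) k)).Infinite := by
    refine Set.infinite_of_injective_forall_mem (f := fun a : k => a • f)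
      (smul_left_injective k hf0) fun a => ?_
    exact (I.restrictScalars k).smul_mem a hf
  clear hbot
  induction r, hcard using Nat.le_induction with
  | base => exact ⟨s, rfl, hs⟩
  | succ r _ ih =>
    obtain ⟨t, ht, htI⟩ := ih
    obtain ⟨g, hg, hgt⟩ := hinf.exists_notMem_finset t
    refine ⟨insert g t, by rw [Finset.card_insert_of_notMem hgt, ht], ?_⟩
    rw [Finset.coe_insert, Ideal.span_insert, htI, sup_eq_right, Ideal.span_singleton_le_iff_mem]
    exact hg

/-- The quotient by `G` near the image of `v` looks like the quotient by the stabilizer `H` of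
`v` near the origin. -/
lemma exists_localIso [CharZero k] {n m m' : ℕ}
    {Wt G Wt' H : Subgroup (Matrix.GeneralLinearGroup (Fin n) k)}
    {p : Fin m → MvPolynomial (Fin n) k} {d : Fin m → ℕ} {c : ↥Wt → Fin m → Fin m → k}
    {p' : Fin m' → MvPolynomial (Fin n) k} {d' : Fin m' → ℕ} {c' : ↥Wt' → Fin m' → Fin m' → k}
    (hs : QuotSetup Wt G p d c) (hs' : QuotSetup Wt' H p' d' c') [Finite G] (hHG : H ≤ G)
    (v : Fin n → k)
    (hH : ∀ g ∈ G, g ∈ H ↔ Matrix.mulVec (g : Matrix (Fin n) (Fin n) k) v = v) :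
    ∃ φ : MvPolynomial (Fin m) k →ₐ[k] MvPolynomial (Fin m') k,
      (∀ f, aeval p' (φ f) = translate v (aeval p f)) ∧
      LocalIso φ (pMap p v) (relIdeal p) (relIdeal p') := by
  have : Finite H := Finite.of_injective _ (Subgroup.inclusion_injective hHG)
  have hp0 : pMap p' 0 = 0 := pMap_zero hs'.homog hs'.dpos
  have htrans : ∀ u f, (∀ g ∈ H, Matrix.mulVec (g : Matrix (Fin n) (Fin n) k) u = u) →
      f ∈ invariants H → translate u f ∈ invariants H := fun u f hu hf g hg => by
    rw [← translate_matAct g u (hu g hg), hf g hg]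
  have hv : ∀ g ∈ H, Matrix.mulVec (g : Matrix (Fin n) (Fin n) k) v = v := fun g hg =>
    (hH g (hHG hg)).mp hg
  have hGH : ∀ f ∈ invariants G, f ∈ invariants H := fun f hf g hg => hf g (hHG hg)
  have hp : ∀ f, aeval p f ∈ invariants G := fun f => (mem_invariants_iff_exists hs.gen).mpr ⟨f, rfl⟩
  have hp' : ∀ f, aeval p' f ∈ invariants H := fun f =>
    (mem_invariants_iff_exists hs'.gen).mpr ⟨f, rfl⟩
  have hF : ∀ i, ∃ F, aeval p' F = translate v (p i) := fun i =>
    (mem_invariants_iff_exists hs'.gen).mp <| htrans v _ hv <| hGH _ <| by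
      simpa using hp (X i)
  choose F hF using hF
  have hφ : ∀ f, aeval p' (aeval F f) = translate v (aeval p f) := fun f => by
    have h : (aeval p').comp (aeval F) = (translate v).comp (aeval p) := by
      apply MvPolynomial.algHom_ext
      intro i
      rw [AlgHom.comp_apply, AlgHom.comp_apply, aeval_X, aeval_X, hF]
    exact DFunLike.congr_fun h f
  refine ⟨aeval F, hφ, ⟨fun f => ?_, relIdeal_le_sq hs', relIdeal_le_ptIdeal p v, fun f hf => ?_,
    fun y => ?_, fun j => ?_⟩⟩
  · rw [← hp0, ← eval_aeval, hφ, eval_translate, zero_add, eval_aeval]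
  · rw [mem_relIdeal] at *
    rw [hφ, hf, map_zero]
  · obtain ⟨N, hN⟩ := exists_order_bound hs'.gen 0 2
    have h1 : translate (-v) (aeval p' y) ∈ invariants H :=
      htrans _ _ (fun g hg => by rw [Matrix.mulVec_neg, hv g hg]) (hp' y)
    obtain ⟨f, hf, hfN⟩ := exists_invariant_approx G H v hH h1 N
    obtain ⟨u, rfl⟩ := (mem_invariants_iff_exists hs.gen).mp hf
    have h2 := translate_mem_pow hfN
    rw [map_sub, translate_neg_translate, ← hφ, ← map_sub] at h2
    obtain ⟨z, hz, hzy⟩ := hN _ (hp' _) h2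
    rw [hp0] at hz
    refine ⟨u, ?_⟩
    have h3 : (y - aeval F u) - z ∈ relIdeal p' := by
      rw [mem_relIdeal, map_sub, hzy, sub_self]
    have h4 := add_mem (relIdeal_le_sq hs' h3) hz
    rwa [sub_add_cancel] at h4
  · obtain ⟨N, hN⟩ := exists_order_bound hs.gen v j
    refine ⟨N, fun f z hz hfz => ?_⟩
    rw [mem_relIdeal, map_sub, hφ, sub_eq_zero] at hfz
    have h1 : aeval p' z ∈ ptIdeal (0 : Fin n → k) ^ N :=
      mem_pow_of_map_mem _ (fun g hg => by
        rw [mem_ptIdeal] at *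
        rw [eval_aeval, hp0, hg]) hz
    rw [← hfz] at h1
    obtain ⟨u, hu, huf⟩ := hN _ (hp f) (mem_pow_of_translate h1)
    rw [← add_sub_cancel u f]
    refine add_mem (Submodule.mem_sup_left hu) (Submodule.mem_sup_right ?_)
    rw [mem_relIdeal, map_sub, huf, sub_self]

lemma sub_mem_of_mem_sq {m m' : ℕ} {ψ₁ ψ₂ : MvPolynomial (Fin m) k →ₐ[k] MvPolynomial (Fin m') k}
    {M : Ideal (MvPolynomial (Fin m) k)} {M' I' : Ideal (MvPolynomial (Fin m') k)}
    (h₁ : ∀ f ∈ M, ψ₁ f ∈ M') (h₂ : ∀ f ∈ M, ψ₂ f ∈ M') (h : ∀ f, ψ₁ f - ψ₂ f ∈ I')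
    {f : MvPolynomial (Fin m) k} (hf : f ∈ M ^ 2) : ψ₁ f - ψ₂ f ∈ M' * I' := by
  rw [pow_two] at hf
  induction hf using Submodule.mul_induction_on' with
  | mem_mul_mem x hx y hy =>
    have e : ψ₁ (x * y) - ψ₂ (x * y)
        = ψ₁ x * (ψ₁ y - ψ₂ y) + ψ₂ y * (ψ₁ x - ψ₂ x) := by
      rw [map_mul, map_mul]; ring
    rw [e]
    exact add_mem (Ideal.mul_mem_mul (h₁ x hx) (h y)) (Ideal.mul_mem_mul (h₂ y hy) (h x))
  | add x _ y _ hx hy =>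
    rw [map_add, map_add, add_sub_add_comm]
    exact add_mem hx hy

lemma isGoodQuot_pointStab [CharZero k] {n m m' : ℕ}
    {Wt G : Subgroup (Matrix.GeneralLinearGroup (Fin n) k)} {L : Submodule k (Fin n → k)}
    {p : Fin m → MvPolynomial (Fin n) k} {d : Fin m → ℕ} {c : ↥Wt → Fin m → Fin m → k}
    {p' : Fin m' → MvPolynomial (Fin n) k} {d' : Fin m' → ℕ}
    {c' : ↥(Wt ⊓ pointStab L) → Fin m' → Fin m' → k}
    (hs : QuotSetup Wt G p d c) (hgood : IsGoodQuot Wt p c)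
    (hs' : QuotSetup (Wt ⊓ pointStab L) (G ⊓ pointStab L) p' d' c') :
    IsGoodQuot (Wt ⊓ pointStab L) p' c' := by
  have : Finite G := (hs.finite.subset hs.le).to_subtype
  obtain ⟨v, hvL, hv⟩ := exists_generic G L
  obtain ⟨φ, hφ, hloc⟩ := exists_localIso hs hs' inf_le_left v fun g hg =>
    ⟨fun h => h.2 v hvL, fun h => ⟨hg, hv g hg h⟩⟩
  obtain ⟨⟨s, hcard, hsI⟩, htriv⟩ := hgood
  constructor
  · obtain ⟨W, _, hrank, -, hW⟩ := hloc.exists_finrank_le s hsI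
    rw [← idealPlus_eq_ptIdeal] at hW
    obtain ⟨t, ht, htI⟩ := exists_generators_of_finrank hs'.dpos
      (fun f hf e => component_mem_relIdeal hs'.homog hf e) W hW
    refine exists_generators_card_eq (by omega) htI fun h => ?_
    have := le_of_relIdeal_eq_bot h
    omega
  · intro w g hg
    rw [idealPlus_eq_ptIdeal]
    have hpoly : ∀ f ∈ ptIdeal (0 : Fin m' → k), polyAct (c' w) f ∈ ptIdeal (0 : Fin m' → k) := by
      intro f hf
      have h := hs'.eval_polyAct w (v := 0) (by simp) f
      rw [pMap_zero hs'.homog hs'.dpos] at h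
      rwa [mem_ptIdeal, h]
    have hlift : ∀ (l : ℕ) (a : Fin l → k) (I : Ideal (MvPolynomial (Fin l) k))
        (ψ : MvPolynomial (Fin l) k →ₐ[k] MvPolynomial (Fin m') k),
        (∀ f ∈ ptIdeal a, ψ f ∈ ptIdeal (0 : Fin m' → k)) → (∀ f ∈ I, ψ f ∈ relIdeal p') →
        ∀ f ∈ ptIdeal a * I, ψ f ∈ ptIdeal (0 : Fin m' → k) * relIdeal p' := by
      intro l a I ψ h1 h2 f hf
      have h3 := Ideal.mem_map_of_mem ψ hf
      rw [Ideal.map_mul] at h3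
      exact Ideal.mul_mono (Ideal.map_le_iff_le_comap.mpr h1) (Ideal.map_le_iff_le_comap.mpr h2) h3
    obtain ⟨f, hf, hf2, hgf⟩ := hloc.exists_sub_map_mem hg
    let w' : ↥Wt := ⟨w, w.2.1⟩
    have h1 : polyAct (c' w) (g - φ f) ∈ ptIdeal (0 : Fin m' → k) * relIdeal p' :=
      hlift m' 0 _ _ hpoly (fun _ hf => hs'.polyAct_mem_relIdeal w hf) _ hgf
    have hwv : Matrix.mulVec
        ((w : Matrix.GeneralLinearGroup (Fin n) k) : Matrix (Fin n) (Fin n) k) v = v :=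
      w.2.2 v hvL
    have h2 : ((polyAct (c' w)).comp φ) f - (φ.comp (polyAct (c w'))) f
        ∈ ptIdeal (0 : Fin m' → k) * relIdeal p' := by
      refine sub_mem_of_mem_sq (M := ptIdeal (pMap p v)) (fun f hf => ?_) (fun f hf => ?_)
        (fun f => ?_) hf2
      · exact hpoly _ (hloc.map_ptIdeal.mpr hf)
      · refine hloc.map_ptIdeal.mpr ?_
        exact (hs.eval_polyAct w' hwv f).trans hf
      · rw [mem_relIdeal, map_sub, AlgHom.comp_apply, AlgHom.comp_apply, hs'.aeval_polyAct, hφ, hφ,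
          hs.aeval_polyAct, translate_matAct _ v hwv, sub_self]
    have h3 : φ (polyAct (c w') f - f) ∈ ptIdeal (0 : Fin m' → k) * relIdeal p' :=
      hlift m _ _ φ (fun _ hf => hloc.map_ptIdeal.mpr hf) hloc.map_mem _
        (hs.polyAct_sub_mem htriv w' hwv hf)
    have h4 := sub_mem (add_mem (add_mem h1 h2) h3) hgf
    convert! h4 using 1
    simp only [map_sub, AlgHom.comp_apply]
    ring

/-- if `G` is good in `Wt` and `L` is a subspace of `Vt`, then
`G_L = G ∩ Wt_L` is a good normal subgroup of the pointwise stabilizer `Wt_L`,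
and the canonical homomorphism `Wt_L/G_L → W` is injective with image the
pointwise stabilizer in `W` of `p(L)`. -/
theorem statement4 [CharZero k] {n m : ℕ}
    (Wt G : Subgroup (Matrix.GeneralLinearGroup (Fin n) k))
    (p : Fin m → MvPolynomial (Fin n) k) (d : Fin m → ℕ)
    (c : ↥Wt → Fin m → Fin m → k)
    (hsetup : QuotSetup Wt G p d c)
    (hgood : IsGoodQuot Wt p c)
    (L : Submodule k (Fin n → k)) :
    -- `G_L` is a good normal subgroup of `Wt_L`
    (∀ (m' : ℕ) (p' : Fin m' → MvPolynomial (Fin n) k) (d' : Fin m' → ℕ)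
        (c' : ↥(Wt ⊓ pointStab L) → Fin m' → Fin m' → k),
        QuotSetup (Wt ⊓ pointStab L) (G ⊓ pointStab L) p' d' c' →
        IsGoodQuot (Wt ⊓ pointStab L) p' c')
    -- the canonical homomorphism `Wt_L/G_L → W = Wt/G` is injective …
    ∧ (∀ u : Matrix.GeneralLinearGroup (Fin n) k,
        u ∈ Wt ⊓ pointStab L → u ∈ G → u ∈ G ⊓ pointStab L)
    -- … with image the pointwise stabilizer in `W` of `p(L)`
    ∧ (∀ w : ↥Wt,
        (∀ x ∈ L, Matrix.mulVec (qMat c w) (pMap p x) = pMap p x)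
          ↔ ∃ g ∈ G, ∃ u ∈ Wt ⊓ pointStab L,
              (w : Matrix.GeneralLinearGroup (Fin n) k) = g * u) := by
  have : Finite G := (hsetup.finite.subset hsetup.le).to_subtype
  exact ⟨fun _ _ _ _ hs' => isGoodQuot_pointStab hsetup hgood hs',
    fun _ hu hg => ⟨hg, hu.2⟩, fixes_image_iff hsetup L⟩
end ReflQuot
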